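/- arXiv:1801.04484 — 4 statements merged into one kernel-verified Lean document; each statement's English description precedes it below -/
import Mathlib

section
/- Let G be a residually finite group and let M be a finitely generated module over the integral group ring ℤG that is torsion-free as an abelian group. Then M is a free ℤG-module if and only if for every subgroup H of finite index in G one has d_H(M) = [G:H]·d_G(M), where d_H(M) denotes the minimal number of generators of M as a ℤH-module. -/
/-- A group `G` is residually finite if every nontrivial element avoids some
normal subgroup of finite index. -/
def ResiduallyFinite (G : Type*) [Group G] : Prop :=
  ∀ g : G, g ≠ 1 → ∃ N : Subgroup G, N.Normal ∧ N.FiniteIndex ∧ g ∉ N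

/-- The minimal number of generators of an `R`-module `M`: the least `n` such that
there is a surjective `R`-linear map `R^n → M`. -/
noncomputable def minNumGen (R M : Type*) [Ring R] [AddCommGroup M] [Module R M] : ℕ :=
  sInf {n : ℕ | ∃ φ : (Fin n → R) →ₗ[R] M, Function.Surjective φ}

lemma minNumGen_le_of_span {R M : Type*} [Ring R] [AddCommGroup M] [Module R M]
    {ι : Type*} [Fintype ι] (v : ι → M) (hv : Submodule.span R (Set.range v) = ⊤) :
    minNumGen R M ≤ Fintype.card ι := by
  refine Nat.sInf_le ⟨Fintype.linearCombination R (v ∘ (Fintype.equivFin ι).symm), ?_⟩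
  rw [← LinearMap.range_eq_top, Fintype.range_linearCombination,
    (Fintype.equivFin ι).symm.surjective.range_comp, hv]

lemma exists_minNumGen {R M : Type*} [Ring R] [AddCommGroup M] [Module R M]
    {k : ℕ} (φ : (Fin k → R) →ₗ[R] M) (hφ : Function.Surjective φ) :
    ∃ φ : (Fin (minNumGen R M) → R) →ₗ[R] M, Function.Surjective φ :=
  Nat.sInf_mem (s := {n : ℕ | ∃ φ : (Fin n → R) →ₗ[R] M, Function.Surjective φ}) ⟨k, φ, hφ⟩

lemma exists_minNumGen_of_span {R M : Type*} [Ring R] [AddCommGroup M] [Module R M]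
    {ι : Type*} [Fintype ι] (v : ι → M) (hv : Submodule.span R (Set.range v) = ⊤) :
    ∃ φ : (Fin (minNumGen R M) → R) →ₗ[R] M, Function.Surjective φ := by
  refine exists_minNumGen (Fintype.linearCombination R (v ∘ (Fintype.equivFin ι).symm)) ?_
  rw [← LinearMap.range_eq_top, Fintype.range_linearCombination,
    (Fintype.equivFin ι).symm.surjective.range_comp, hv]

/-- Lower bound for the number of generators through a semilinear surjection onto an abelian
group. -/
lemma finrank_le_of_surj {R M N : Type*} [Ring R] [AddCommGroup M] [Module R M]
    [AddCommGroup N] (ε : R →+* ℤ) (f : M →+ N) (hf : Function.Surjective f)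
    (hs : ∀ (r : R) (x : M), f (r • x) = ε r • f x) {k : ℕ}
    (φ : (Fin k → R) →ₗ[R] M) (hφ : Function.Surjective φ) :
    Module.finrank ℤ N ≤ k := by
  have hsurj : Function.Surjective
      (Fintype.linearCombination ℤ (fun i : Fin k => f (φ (Pi.single i 1)))) := by
    intro y
    obtain ⟨x, rfl⟩ := hf y
    obtain ⟨z, rfl⟩ := hφ x
    refine ⟨fun i => ε (z i), ?_⟩
    rw [Fintype.linearCombination_apply]
    conv_rhs => rw [pi_eq_sum_univ' z]
    rw [map_sum, map_sum]
    refine Finset.sum_congr rfl fun i _ => ?_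
    rw [← hs, ← map_smul]
  have := LinearMap.finrank_range_le (Fintype.linearCombination ℤ (fun i : Fin k => f (φ (Pi.single i 1))))
  rw [LinearMap.range_eq_top.2 hsurj] at this
  simpa using this

/-- Augmentation of the integral group ring. -/
noncomputable def augm (G : Type*) [Group G] : MonoidAlgebra ℤ G →+* ℤ :=
  ((MonoidAlgebra.lift ℤ ℤ G) (1 : G →* ℤ)).toRingHom

lemma augm_single {G : Type*} [Group G] (g : G) (a : ℤ) :
    augm G (MonoidAlgebra.single g a) = a := by
  simp [augm]

lemma span_translates {G : Type*} [Group G] (H : Subgroup G) {M : Type*} [AddCommGroup M]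
    [Module (MonoidAlgebra ℤ G) M] [Module (MonoidAlgebra ℤ ↥H) M]
    (hc : ∀ (r : MonoidAlgebra ℤ ↥H) (x : M),
      r • x = MonoidAlgebra.mapDomainRingHom ℤ H.subtype r • x)
    (τ : G ⧸ H → G) (hτ : ∀ c, (QuotientGroup.mk (τ c)⁻¹ : G ⧸ H) = c)
    {n : ℕ} (m : Fin n → M)
    (hm : Submodule.span (MonoidAlgebra ℤ G) (Set.range m) = ⊤) :
    Submodule.span (MonoidAlgebra ℤ ↥H)
      (Set.range fun p : (G ⧸ H) × Fin n =>
        (MonoidAlgebra.single (τ p.1) (1 : ℤ) : MonoidAlgebra ℤ G) • m p.2) = ⊤ := by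
  set L := Submodule.span (MonoidAlgebra ℤ ↥H)
      (Set.range fun p : (G ⧸ H) × Fin n =>
        (MonoidAlgebra.single (τ p.1) (1 : ℤ) : MonoidAlgebra ℤ G) • m p.2) with hL
  have key : ∀ (r : MonoidAlgebra ℤ G) (i : Fin n), r • m i ∈ L := by
    intro r i
    induction r using MonoidAlgebra.induction_linear with
    | zero => simp
    | add x y hx hy => rw [add_smul]; exact L.add_mem hx hy
    | single g a =>
      have hg : g * (τ (QuotientGroup.mk g⁻¹))⁻¹ ∈ H := by
        have := (QuotientGroup.eq (s := H)).1 (hτ (QuotientGroup.mk g⁻¹)).symm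
        simpa using this
      have h1 : (MonoidAlgebra.single g a : MonoidAlgebra ℤ G) • m i =
          (MonoidAlgebra.single (⟨_, hg⟩ : ↥H) a : MonoidAlgebra ℤ ↥H) •
          ((MonoidAlgebra.single (τ (QuotientGroup.mk g⁻¹)) (1 : ℤ) : MonoidAlgebra ℤ G)
            • m i) := by
        rw [hc, smul_smul]
        congr 1
        simp [MonoidAlgebra.mapDomainRingHom, MonoidAlgebra.single_mul_single]
      rw [h1]
      exact L.smul_mem _ (Submodule.subset_span ⟨(_, i), rfl⟩)
  rw [eq_top_iff]
  intro x _
  have hx : x ∈ Submodule.span (MonoidAlgebra ℤ G) (Set.range m) := hm ▸ Submodule.mem_top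
  obtain ⟨c, rfl⟩ := (Submodule.mem_span_range_iff_exists_fun _).1 hx
  exact L.sum_mem fun i _ => key _ _

/-- The projection to right cosets (coded by left cosets of inverses). -/
noncomputable def cosetProj {G : Type*} [Group G] (H : Subgroup G) :
    MonoidAlgebra ℤ G →+ (G ⧸ H →₀ ℤ) where
  toFun x := Finsupp.mapDomain (fun g => (QuotientGroup.mk g⁻¹ : G ⧸ H)) x.coeff
  map_zero' := by simp
  map_add' x y := by simp [Finsupp.mapDomain_add]

lemma cosetProj_single {G : Type*} [Group G] (H : Subgroup G) (g : G) (a : ℤ) :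
    cosetProj H (MonoidAlgebra.single g a) =
      Finsupp.single (QuotientGroup.mk g⁻¹ : G ⧸ H) a := by
  simp [cosetProj]

lemma cosetProj_surjective {G : Type*} [Group G] (H : Subgroup G) :
    Function.Surjective (cosetProj H) := by
  intro y
  induction y using Finsupp.induction_linear with
  | zero => exact ⟨0, map_zero _⟩
  | add x y hx hy =>
    obtain ⟨a, rfl⟩ := hx
    obtain ⟨b, rfl⟩ := hy
    exact ⟨a + b, map_add _ _ _⟩
  | single c a =>
    obtain ⟨g, rfl⟩ := QuotientGroup.mk_surjective c
    exact ⟨MonoidAlgebra.single g⁻¹ a, by simp [cosetProj_single]⟩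

lemma cosetProj_mul {G : Type*} [Group G] (H : Subgroup G) (r : MonoidAlgebra ℤ ↥H)
    (x : MonoidAlgebra ℤ G) :
    cosetProj H (MonoidAlgebra.mapDomainRingHom ℤ H.subtype r * x) =
      augm ↥H r • cosetProj H x := by
  induction r using MonoidAlgebra.induction_linear with
  | zero => simp
  | add r s hr hs => rw [map_add, add_mul, map_add, hr, hs, map_add, add_smul]
  | single h a =>
    induction x using MonoidAlgebra.induction_linear with
    | zero => simp
    | add x y hx hy => rw [mul_add, map_add, hx, hy, map_add, smul_add]
    | single g b =>
      have : MonoidAlgebra.mapDomainRingHom ℤ H.subtype (MonoidAlgebra.single h a) =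
          MonoidAlgebra.single (h : G) a := by
        simp [MonoidAlgebra.mapDomainRingHom]
      rw [this, MonoidAlgebra.single_mul_single, cosetProj_single, cosetProj_single,
        augm_single, Finsupp.smul_single, smul_eq_mul]
      congr 1
      rw [QuotientGroup.eq]
      simp

lemma exists_section {G : Type*} [Group G] (H : Subgroup G) (S : Set G)
    (hS : ∀ s ∈ S, ∀ t ∈ S, s * t⁻¹ ∈ H → s = t) :
    ∃ τ : G ⧸ H → G, (∀ c, (QuotientGroup.mk (τ c)⁻¹ : G ⧸ H) = c) ∧ S ⊆ Set.range τ := by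
  classical
  have : ∀ c : G ⧸ H, ∃ g : G, (QuotientGroup.mk g⁻¹ : G ⧸ H) = c ∧
      ∀ s ∈ S, (QuotientGroup.mk s⁻¹ : G ⧸ H) = c → g = s := by
    intro c
    by_cases h : ∃ s ∈ S, (QuotientGroup.mk s⁻¹ : G ⧸ H) = c
    · obtain ⟨s, hs, hsc⟩ := h
      refine ⟨s, hsc, fun t ht htc => hS s hs t ht ?_⟩
      have := (QuotientGroup.eq (s := H)).1 (hsc.trans htc.symm)
      simpa using this
    · obtain ⟨g, rfl⟩ := QuotientGroup.mk_surjective c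
      exact ⟨g⁻¹, by simp, fun s hs hsc => (h ⟨s, hs, hsc⟩).elim⟩
  choose τ h1 h2 using this
  exact ⟨τ, h1, fun s hs => ⟨_, h2 _ s hs rfl⟩⟩

lemma exists_sep {G : Type*} [Group G] (hG : ResiduallyFinite G) (S : Finset G) :
    ∃ H : Subgroup G, H.FiniteIndex ∧ ∀ s ∈ S, ∀ t ∈ S, s * t⁻¹ ∈ H → s = t := by
  classical
  have : ∀ g : G, ∃ N : Subgroup G, N.FiniteIndex ∧ (g ∈ N → g = 1) := by
    intro g
    by_cases hg : g = 1
    · exact ⟨⊤, inferInstance, fun _ => hg⟩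
    · obtain ⟨N, -, h2, h3⟩ := hG g hg
      exact ⟨N, h2, fun h => (h3 h).elim⟩
  choose N hN hN' using this
  refine ⟨⨅ p : S × S, N (p.1.1 * p.2.1⁻¹), Subgroup.finiteIndex_iInf fun p => hN _, ?_⟩
  intro s hs t ht h
  have := Subgroup.mem_iInf.1 h (⟨s, hs⟩, ⟨t, ht⟩)
  exact mul_inv_eq_one.1 (hN' _ this)

/-- Integral relation among generators in a torsion-free module drops a generator. -/
lemma minNumGen_lt {R M : Type*} [Ring R] [AddCommGroup M] [Module R M]
    (htf : ∀ (k : ℤ) (x : M), k • x = 0 → k = 0 ∨ x = 0)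
    {ι : Type*} [Fintype ι] (v : ι → M) (hv : Submodule.span R (Set.range v) = ⊤)
    (a : ι → ℤ) (ha : a ≠ 0) (hrel : ∑ j, a j • v j = 0) :
    minNumGen R M < Fintype.card ι := by
  have : Module.IsTorsionFree ℤ M := by
    rw [Module.isTorsionFree_iff_smul_eq_zero]
    exact fun k x h => htf k x h
  set L := Submodule.span ℤ (Set.range v) with hL
  have : Module.Finite ℤ L := Module.Finite.span_of_finite ℤ (Set.finite_range v)
  have : Module.Free ℤ L := inferInstance
  have hlt : Module.finrank ℤ L < Fintype.card ι := by
    by_contra hcon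
    push Not at hcon
    have hli : LinearIndependent ℤ v := linearIndependent_iff_card_le_finrank_span.2 hcon
    exact ha (funext (Fintype.linearIndependent_iff.1 hli a hrel))
  let b := Module.finBasis ℤ L
  refine lt_of_le_of_lt (minNumGen_le_of_span (fun i => (b i : M)) ?_) (by simpa using hlt)
  rw [eq_top_iff, ← hv, Submodule.span_le]
  rintro _ ⟨j, rfl⟩
  have hj : v j ∈ L := Submodule.subset_span ⟨j, rfl⟩
  have h2 := congrArg Subtype.val (b.sum_repr ⟨v j, hj⟩)
  simp only [Submodule.coe_sum, Submodule.coe_smul] at h2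
  rw [← h2]
  exact Submodule.sum_mem _ fun i _ => zsmul_mem (Submodule.subset_span (Set.mem_range_self i)) _

theorem stmt_1 {G : Type*} [Group G] (hG : ResiduallyFinite G)
    (M : Type*) [AddCommGroup M] [Module (MonoidAlgebra ℤ G) M]
    (hfg : Module.Finite (MonoidAlgebra ℤ G) M)
    (htf : ∀ (k : ℤ) (x : M), k • x = 0 → k = 0 ∨ x = 0) :
    Module.Free (MonoidAlgebra ℤ G) M ↔
      ∀ H : Subgroup G, H.FiniteIndex →
        (letI : Module (MonoidAlgebra ℤ ↥H) M :=
          Module.compHom M (MonoidAlgebra.mapDomainRingHom ℤ H.subtype)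
         minNumGen (MonoidAlgebra ℤ ↥H) M = H.index * minNumGen (MonoidAlgebra ℤ G) M) := by
  classical
  constructor
  · intro hfree H hH
    let _ : Module (MonoidAlgebra ℤ ↥H) M :=
          Module.compHom M (MonoidAlgebra.mapDomainRingHom ℤ H.subtype)
    show minNumGen (MonoidAlgebra ℤ ↥H) M = H.index * minNumGen (MonoidAlgebra ℤ G) M
    have hc : ∀ (r : MonoidAlgebra ℤ ↥H) (x : M),
      r • x = MonoidAlgebra.mapDomainRingHom ℤ H.subtype r • x := fun r x => rfl
    have : Fintype (G ⧸ H) := Fintype.ofFinite _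
    have : Nontrivial (MonoidAlgebra ℤ G) := (augm G).domain_nontrivial
    obtain ⟨n, ⟨b⟩⟩ : ∃ n : ℕ, Nonempty (Module.Basis (Fin n) (MonoidAlgebra ℤ G) M) := by
      let b0 := Module.Free.chooseBasis (MonoidAlgebra ℤ G) M
      have : Finite (Module.Free.ChooseBasisIndex (MonoidAlgebra ℤ G) M) :=
        Module.Finite.finite_basis b0
      have := Fintype.ofFinite (Module.Free.ChooseBasisIndex (MonoidAlgebra ℤ G) M)
      exact ⟨_, ⟨b0.reindex (Fintype.equivFin _)⟩⟩
    have hn : minNumGen (MonoidAlgebra ℤ G) M = n := by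
      apply le_antisymm
      · simpa using minNumGen_le_of_span b b.span_eq
      · obtain ⟨φ, hφ⟩ := exists_minNumGen_of_span b b.span_eq
        let f : M →+ (Fin n → ℤ) :=
          { toFun := fun x i => augm G (b.equivFun x i)
            map_zero' := by ext; simp
            map_add' := fun x y => by ext; simp }
        have := finrank_le_of_surj (augm G) f (fun y => ⟨b.equivFun.symm
          (fun i => MonoidAlgebra.single 1 (y i)), by
            ext i; simp [f, augm_single, -Module.Basis.equivFun_symm_apply,
              -Module.Basis.equivFun_apply]⟩)
          (fun r x => by ext i; simp [f]) φ hφ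
        simpa using this
    have hidx : H.index = Fintype.card (G ⧸ H) := by
      rw [Subgroup.index, Nat.card_eq_fintype_card]
    rw [hn, hidx]
    obtain ⟨τ, hτ, -⟩ := exists_section H ∅ (by simp)
    have hspan := span_translates H hc τ hτ b b.span_eq
    apply le_antisymm
    · simpa using minNumGen_le_of_span _ hspan
    · obtain ⟨φ, hφ⟩ := exists_minNumGen_of_span _ hspan
      let f : M →+ (Fin n → (G ⧸ H →₀ ℤ)) :=
        { toFun := fun x i => cosetProj H (b.equivFun x i)
          map_zero' := by ext; simp
          map_add' := fun x y => by ext; simp }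
      have hf : Function.Surjective f := by
        intro y
        choose z hz using fun i => cosetProj_surjective H (y i)
        refine ⟨b.equivFun.symm z, ?_⟩
        funext i
        show cosetProj H (b.equivFun (b.equivFun.symm z) i) = y i
        rw [LinearEquiv.apply_symm_apply, hz]
      have := finrank_le_of_surj (augm ↥H) f hf (fun r x => by
        funext i
        show cosetProj H (b.equivFun (r • x) i) = augm ↥H r • cosetProj H (b.equivFun x i)
        rw [hc, map_smul, Pi.smul_apply, smul_eq_mul, cosetProj_mul]) φ hφ
      rw [Module.finrank_pi_fintype] at this
      simpa [mul_comm] using this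
  · intro hd
    obtain ⟨k, φ0, hφ0⟩ := Module.Finite.exists_fin' (MonoidAlgebra ℤ G) M
    obtain ⟨φ, hφ⟩ := exists_minNumGen φ0 hφ0
    generalize hn : minNumGen (MonoidAlgebra ℤ G) M = n at *
    suffices hinj : Function.Injective φ from
      Module.Free.of_equiv (LinearEquiv.ofBijective φ ⟨hinj, hφ⟩)
    rw [injective_iff_map_eq_zero]
    intro x hx
    by_contra hx0
    let S : Finset G := Finset.univ.biUnion fun i => (x i).coeff.support
    obtain ⟨H, hH, hS⟩ := exists_sep hG S
    obtain ⟨τ, hτ, hSτ⟩ := exists_section H (S : Set G) (by simpa using hS)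
    have hτinj : Function.Injective τ := fun c d h => by rw [← hτ c, ← hτ d, h]
    let _ : Module (MonoidAlgebra ℤ ↥H) M :=
          Module.compHom M (MonoidAlgebra.mapDomainRingHom ℤ H.subtype)
    have hd' : minNumGen (MonoidAlgebra ℤ ↥H) M = H.index * n := hd H hH
    have hc : ∀ (r : MonoidAlgebra ℤ ↥H) (x : M),
      r • x = MonoidAlgebra.mapDomainRingHom ℤ H.subtype r • x := fun r x => rfl
    have : Fintype (G ⧸ H) := Fintype.ofFinite _
    let m : Fin n → M := fun i => φ (Pi.single i 1)
    have hφm : ∀ z, φ z = ∑ i, z i • m i := by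
      intro z
      conv_lhs => rw [pi_eq_sum_univ' z]
      rw [map_sum]
      refine Finset.sum_congr rfl fun i _ => ?_
      rw [← map_smul]
    have hm : Submodule.span (MonoidAlgebra ℤ G) (Set.range m) = ⊤ := by
      rw [eq_top_iff]
      intro y _
      obtain ⟨z, rfl⟩ := hφ y
      rw [hφm]
      exact Submodule.sum_mem _ fun i _ =>
        Submodule.smul_mem _ _ (Submodule.subset_span ⟨i, rfl⟩)
    have hspan := span_translates H hc τ hτ m hm
    have hxi : ∀ i, x i = ∑ c, (x i).coeff (τ c) •
        (MonoidAlgebra.single (τ c) (1 : ℤ) : MonoidAlgebra ℤ G) := by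
      intro i
      conv_lhs => rw [← MonoidAlgebra.sum_coeff_single (x i)]
      have h1 : (x i).coeff.support ⊆ Finset.univ.image τ := by
        intro g hg
        have hgS : g ∈ (S : Set G) := by
          simp only [S, Finset.coe_biUnion, Set.mem_iUnion]
          exact ⟨i, by simp, hg⟩
        obtain ⟨c, rfl⟩ := hSτ hgS
        simp
      rw [Finsupp.sum_of_support_subset _ h1 _ (by simp),
        Finset.sum_image (fun c _ d _ h => hτinj h)]
      refine Finset.sum_congr rfl fun c _ => ?_
      rw [MonoidAlgebra.smul_single]
      simp
    have hlt := minNumGen_lt (R := MonoidAlgebra ℤ ↥H) htf _ hspan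
      (fun p => (x p.2).coeff (τ p.1)) (by
        intro h0
        apply hx0
        funext i
        rw [hxi i]
        exact Finset.sum_eq_zero fun c _ => by
          rw [show (x i).coeff (τ c) = 0 from congrFun h0 (c, i), zero_smul]) (by
        rw [← hx, hφm, Fintype.sum_prod_type_right]
        refine Finset.sum_congr rfl fun i _ => ?_
        conv_rhs => rw [hxi i, Finset.sum_smul]
        refine Finset.sum_congr rfl fun c _ => ?_
        rw [smul_assoc])
    rw [hd', Fintype.card_prod, Fintype.card_fin, Subgroup.index, Nat.card_eq_fintype_card] at hlt
    exact lt_irrefl _ hlt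
end

section
/- Let G be a finitely generated residually finite group. Then G is a free group if and only if for every subgroup H of finite index in G one has d(H) − 1 = [G:H]·(d(G) − 1), where d(·) denotes the minimal number of generators of a group. -/
/-- `d(G)`: the minimal number of generators of the group `G`, i.e. the least `n`
such that some `n` elements of `G` generate `G`. -/
noncomputable def dGroup (G : Type*) [Group G] : ℕ :=
  sInf {n : ℕ | ∃ v : Fin n → G, Subgroup.closure (Set.range v) = ⊤}


section helpers

open Classical in
theorem dGroup_le_card {G : Type*} [Group G] {ι : Type*} [Fintype ι] (v : ι → G)
    (hv : Subgroup.closure (Set.range v) = ⊤) : dGroup G ≤ Fintype.card ι := by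
  apply Nat.sInf_le
  refine ⟨v ∘ (Fintype.equivFin ι).symm, ?_⟩
  rw [Set.range_comp, Equiv.range_eq_univ, Set.image_univ, hv]

theorem dGroup_spec {G : Type*} [Group G] (h : Group.FG G) :
    ∃ v : Fin (dGroup G) → G, Subgroup.closure (Set.range v) = ⊤ := by
  have hne : {n : ℕ | ∃ v : Fin n → G, Subgroup.closure (Set.range v) = ⊤}.Nonempty := by
    obtain ⟨S, hS⟩ := h.out
    refine ⟨S.card, fun i => (S.equivFin.symm i : G), ?_⟩
    rw [← hS]
    congr 1
    ext x
    constructor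
    · rintro ⟨i, rfl⟩
      simp
    · intro hx
      exact ⟨S.equivFin ⟨x, hx⟩, by simp⟩
  exact Nat.sInf_mem hne

theorem finite_of_freeGroup_fg {X : Type*} (h : Group.FG (FreeGroup X)) : Finite X := by
  have h1 : Group.FG (Abelianization (FreeGroup X)) :=
    Group.fg_of_surjective (f := Abelianization.of) (QuotientGroup.mk_surjective)
  have h2 : AddGroup.FG (FreeAbelianGroup X) :=
    GroupFG.iff_add_fg.1 h1
  have h3 : Module.Finite ℤ (FreeAbelianGroup X) := Module.Finite.iff_addGroup_fg.2 h2
  exact Module.Finite.finite_basis (FreeAbelianGroup.basis X)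

/-- Partial Schreier data. -/
structure Sch {G : Type*} [Group G] (H : Subgroup G) {X : Type*} (v : X → G)
    (S : Finset (G ⧸ H)) (T : Finset ((G ⧸ H) × X)) (t : (G ⧸ H) → G) : Prop where
  base : ((1 : G) : G ⧸ H) ∈ S
  t_one : t ((1 : G) : G ⧸ H) = 1
  t_sec : ∀ x ∈ S, (t x : G ⧸ H) = x
  src : ∀ e ∈ T, e.1 ∈ S
  tgt : ∀ e ∈ T, v e.2 • e.1 ∈ S
  triv : ∀ e ∈ T, t (v e.2 • e.1) = v e.2 * t e.1

open Classical in
theorem Sch.step {G : Type*} [Group G] {H : Subgroup G} {X : Type*} {v : X → G}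
    (hv : Subgroup.closure (Set.range v) = ⊤)
    {S : Finset (G ⧸ H)} {T : Finset ((G ⧸ H) × X)} {t : (G ⧸ H) → G}
    (h : Sch H v S T t) (hS : ∃ y, y ∉ S) :
    ∃ S' T' t', Sch H v S' T' t' ∧ S'.card = S.card + 1 ∧ T'.card = T.card + 1 := by
  have key : ∃ (x : G ⧸ H) (i : X), (x ∈ S ∧ v i • x ∉ S) ∨ (x ∉ S ∧ v i • x ∈ S) := by
    by_contra hcon
    push Not at hcon
    have hall : ∀ g : G, ∀ x, x ∈ S ↔ g • x ∈ S := by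
      intro g
      have hg : g ∈ Subgroup.closure (Set.range v) := by rw [hv]; trivial
      induction hg using Subgroup.closure_induction with
      | mem g hg =>
        obtain ⟨i, rfl⟩ := hg
        intro x
        have := hcon x i
        tauto
      | one => simp
      | mul a b _ _ ha hb =>
        intro x
        rw [hb x, ha (b • x), mul_smul]
      | inv a _ ha =>
        intro x
        rw [ha (a⁻¹ • x), smul_inv_smul]
    obtain ⟨y, hy⟩ := hS
    obtain ⟨g, rfl⟩ := QuotientGroup.mk_surjective y
    apply hy
    have := (hall g _).1 h.base
    simpa [MulAction.Quotient.smul_mk] using this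
  obtain ⟨x, i, ⟨hx, hvx⟩ | ⟨hx, hvx⟩⟩ := key
  · refine ⟨insert (v i • x) S, insert (x, i) T, Function.update t (v i • x) (v i * t x),
      ⟨?_, ?_, ?_, ?_, ?_, ?_⟩, Finset.card_insert_of_notMem hvx,
      Finset.card_insert_of_notMem fun hT => hvx (h.tgt _ hT)⟩
    · exact Finset.mem_insert_of_mem h.base
    · rw [Function.update_of_ne, h.t_one]
      intro h1; exact hvx (h1 ▸ h.base)
    · intro y hy
      by_cases hyx : y = v i • x
      · subst hyx
        rw [Function.update_self, ← smul_eq_mul, ← MulAction.Quotient.smul_mk, h.t_sec x hx]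
      · rw [Function.update_of_ne hyx]
        exact h.t_sec y (Finset.mem_of_mem_insert_of_ne hy hyx)
    · intro e he
      rcases Finset.mem_insert.1 he with rfl | he
      · exact Finset.mem_insert_of_mem hx
      · exact Finset.mem_insert_of_mem (h.src e he)
    · intro e he
      rcases Finset.mem_insert.1 he with rfl | he
      · exact Finset.mem_insert_self _ _
      · exact Finset.mem_insert_of_mem (h.tgt e he)
    · intro e he
      rcases Finset.mem_insert.1 he with rfl | he
      · simp only [Function.update_self]
        rw [Function.update_of_ne]
        intro h1; exact hvx (h1 ▸ hx)
      · rw [Function.update_of_ne, Function.update_of_ne, h.triv e he]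
        · intro h1; exact hvx (h1 ▸ h.src e he)
        · intro h1; exact hvx (h1 ▸ h.tgt e he)
  · refine ⟨insert x S, insert (x, i) T, Function.update t x ((v i)⁻¹ * t (v i • x)),
      ⟨?_, ?_, ?_, ?_, ?_, ?_⟩, Finset.card_insert_of_notMem hx,
      Finset.card_insert_of_notMem fun hT => hx (h.src _ hT)⟩
    · exact Finset.mem_insert_of_mem h.base
    · rw [Function.update_of_ne, h.t_one]
      intro h1; exact hx (h1 ▸ h.base)
    · intro y hy
      by_cases hyx : y = x
      · subst hyx
        rw [Function.update_self, ← smul_eq_mul, ← MulAction.Quotient.smul_mk, h.t_sec _ hvx,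
          inv_smul_smul]
      · rw [Function.update_of_ne hyx]
        exact h.t_sec y (Finset.mem_of_mem_insert_of_ne hy hyx)
    · intro e he
      rcases Finset.mem_insert.1 he with rfl | he
      · exact Finset.mem_insert_self _ _
      · exact Finset.mem_insert_of_mem (h.src e he)
    · intro e he
      rcases Finset.mem_insert.1 he with rfl | he
      · exact Finset.mem_insert_of_mem hvx
      · exact Finset.mem_insert_of_mem (h.tgt e he)
    · intro e he
      rcases Finset.mem_insert.1 he with rfl | he
      · simp only [Function.update_self]
        rw [Function.update_of_ne]
        · group
        · intro h1; exact hx (h1 ▸ hvx)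
      · rw [Function.update_of_ne, Function.update_of_ne, h.triv e he]
        · intro h1; exact hx (h1 ▸ h.src e he)
        · intro h1; exact hx (h1 ▸ h.tgt e he)

theorem Sch.extend {G : Type*} [Group G] {H : Subgroup G} [Fintype (G ⧸ H)] {X : Type*} {v : X → G}
    (hv : Subgroup.closure (Set.range v) = ⊤) (n : ℕ) :
    ∀ {S : Finset (G ⧸ H)} {T : Finset ((G ⧸ H) × X)} {t : (G ⧸ H) → G},
    Sch H v S T t → S.card + n = Fintype.card (G ⧸ H) →
    ∃ T' t', Sch H v Finset.univ T' t' ∧ T'.card = T.card + n := by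
  induction n with
  | zero =>
    intro S T t h hc
    have : S = Finset.univ := Finset.card_eq_iff_eq_univ S |>.1 hc
    subst this
    exact ⟨T, t, h, rfl⟩
  | succ n ih =>
    intro S T t h hc
    have : ∃ y, y ∉ S := by
      by_contra hcon
      push Not at hcon
      have := Finset.eq_univ_iff_forall.2 hcon
      rw [this, Finset.card_univ] at hc
      omega
    obtain ⟨S', T', t', h', hS', hT'⟩ := h.step hv this
    obtain ⟨T'', t'', h'', hc''⟩ := ih h' (by omega)
    exact ⟨T'', t'', h'', by omega⟩

open Classical in
theorem Sch.bound_univ {G : Type*} [Group G] {H : Subgroup G} [Fintype (G ⧸ H)] {X : Type*}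
    [Fintype X] {v : X → G}
    (hv : Subgroup.closure (Set.range v) = ⊤)
    {T : Finset ((G ⧸ H) × X)} {t : (G ⧸ H) → G} (h : Sch H v Finset.univ T t) :
    dGroup H + T.card ≤ Fintype.card (G ⧸ H) * Fintype.card X := by
  have hmem : ∀ (g : G) (x : G ⧸ H), (t (g • x))⁻¹ * g * t x ∈ H := by
    intro g x
    rw [mul_assoc, ← QuotientGroup.eq, h.t_sec _ (Finset.mem_univ _), ← smul_eq_mul,
      ← MulAction.Quotient.smul_mk, h.t_sec _ (Finset.mem_univ _)]
  let gen : {e : (G ⧸ H) × X // e ∉ T} → H := fun e => ⟨_, hmem (v e.1.2) e.1.1⟩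
  have hgen : Subgroup.closure (Set.range gen) = ⊤ := by
    set K := (Subgroup.closure (Set.range gen)).map H.subtype with hK
    have hall : ∀ (g : G) (x : G ⧸ H), (t (g • x))⁻¹ * g * t x ∈ K := by
      intro g
      have hg : g ∈ Subgroup.closure (Set.range v) := by rw [hv]; trivial
      induction hg using Subgroup.closure_induction with
      | mem g hg =>
        obtain ⟨i, rfl⟩ := hg
        intro x
        by_cases hT : (x, i) ∈ T
        · have := h.triv _ hT
          simp only at this
          rw [this]
          convert K.one_mem using 1
          group
        · exact ⟨gen ⟨(x, i), hT⟩, Subgroup.subset_closure ⟨_, rfl⟩, rfl⟩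
      | one => intro x; simp
      | mul a b _ _ ha hb =>
        intro x
        have := K.mul_mem (ha (b • x)) (hb x)
        rw [mul_smul]
        convert this using 1
        group
      | inv a _ ha =>
        intro x
        have := K.inv_mem (ha (a⁻¹ • x))
        rw [smul_inv_smul] at this
        convert this using 1
        group
    rw [eq_top_iff]
    rintro ⟨g, hg⟩ -
    have h1 := hall g ((1 : G) : G ⧸ H)
    have h2 : g • ((1 : G) : G ⧸ H) = ((1 : G) : G ⧸ H) := by
      rw [MulAction.Quotient.smul_mk, smul_eq_mul, mul_one]
      exact (QuotientGroup.eq.2 (by simpa using hg)).symm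
    rw [h2, h.t_one] at h1
    obtain ⟨k, hk, hkg⟩ := h1
    have : k = ⟨g, hg⟩ := Subtype.ext (by simpa using hkg)
    exact this ▸ hk
  have := dGroup_le_card gen hgen
  rw [Fintype.card_subtype_compl, Fintype.card_prod] at this
  have h2 : T.card ≤ Fintype.card (G ⧸ H) * Fintype.card X := by
    rw [← Fintype.card_prod]; exact Finset.card_le_univ T
  simp only [Fintype.card_coe] at this
  omega

theorem Sch.bound {G : Type*} [Group G] {H : Subgroup G} [H.FiniteIndex] {X : Type*}
    [Fintype X] {v : X → G}
    (hv : Subgroup.closure (Set.range v) = ⊤) {S : Finset (G ⧸ H)}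
    {T : Finset ((G ⧸ H) × X)} {t : (G ⧸ H) → G} (h : Sch H v S T t) :
    dGroup H + T.card + H.index ≤ H.index * Fintype.card X + S.card := by
  have : Fintype (G ⧸ H) := Fintype.ofFinite _
  have hidx : H.index = Fintype.card (G ⧸ H) := by rw [Subgroup.index, Nat.card_eq_fintype_card]
  have hS : S.card ≤ Fintype.card (G ⧸ H) := Finset.card_le_univ S
  obtain ⟨T', t', h', hc⟩ := h.extend hv (Fintype.card (G ⧸ H) - S.card) (by omega)
  have := h'.bound_univ hv
  rw [hidx]
  omega

/-- Upper Schreier bound. -/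
theorem dGroup_upper {G : Type*} [Group G] (H : Subgroup G) [H.FiniteIndex] {X : Type*}
    [Fintype X] {v : X → G}
    (hv : Subgroup.closure (Set.range v) = ⊤) :
    dGroup H + H.index ≤ H.index * Fintype.card X + 1 := by
  have h : Sch H v {((1 : G) : G ⧸ H)} ∅ (fun _ => 1) :=
    ⟨by simp, rfl, by simp, by simp, by simp, by simp⟩
  simpa using h.bound hv

end helpers

theorem closure_basis {G : Type*} [Group G] {X : Type*} (b : FreeGroupBasis X G) :
    Subgroup.closure (Set.range b) = ⊤ := by
  have h : (Subgroup.closure (Set.range (FreeGroup.of : X → FreeGroup X))).map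
      b.repr.symm.toMonoidHom = Subgroup.closure (Set.range b) := by
    rw [MonoidHom.map_closure, ← Set.range_comp]
    rfl
  rw [← h, FreeGroup.closure_range_of]
  exact Subgroup.map_top_of_surjective _ b.repr.symm.surjective

open Classical in
/-- The twisted permutation attached to a generator. -/
noncomputable def twist {G : Type*} [Group G] {X : Type*} (b : X → G) (H : Subgroup G) (i : X) :
    Equiv.Perm ((G ⧸ H) × (((G ⧸ H) × X) → ℚ)) where
  toFun p := (b i • p.1, p.2 + Pi.single (p.1, i) 1)
  invFun p := ((b i)⁻¹ • p.1, p.2 - Pi.single ((b i)⁻¹ • p.1, i) 1)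
  left_inv p := by simp
  right_inv p := by simp

open Classical in
theorem dGroup_lower {G : Type*} [Group G] {X : Type*} [Fintype X] (b : FreeGroupBasis X G)
    (hfg : Group.FG G) (H : Subgroup G) [H.FiniteIndex] :
    H.index * Fintype.card X + 1 ≤ dGroup H + H.index := by
  have : Fintype (G ⧸ H) := Fintype.ofFinite _
  have hidx : H.index = Fintype.card (G ⧸ H) := by rw [Subgroup.index, Nat.card_eq_fintype_card]
  have hHfg : Group.FG H := inferInstance
  obtain ⟨w, hw⟩ := dGroup_spec hHfg
  let ρ : G →* Equiv.Perm ((G ⧸ H) × (((G ⧸ H) × X) → ℚ)) := b.lift (twist b H)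
  have hρ : ∀ i, ρ (b i) = twist b H i := fun i => by
    simp [ρ]
  have hP : ∀ g x a, ρ g (x, a) = (g • x, a + (ρ g (x, 0)).2) := by
    intro g
    have hg : g ∈ Subgroup.closure (Set.range b) := by rw [closure_basis]; trivial
    induction hg using Subgroup.closure_induction with
    | mem g hg =>
      obtain ⟨i, rfl⟩ := hg
      intro x a
      rw [hρ]
      simp [twist]
    | one => intro x a; simp
    | mul g k _ _ hg hk =>
      intro x a
      rw [map_mul, Equiv.Perm.mul_apply, Equiv.Perm.mul_apply, hk x a, hg (k • x), hk x 0,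
        hg (k • x) (0 + _)]
      simp [mul_smul, add_assoc]
    | inv g _ hg =>
      intro x a
      have h1 : ∀ a, ρ g⁻¹ (x, a) = (g⁻¹ • x, a - (ρ g (g⁻¹ • x, 0)).2) := by
        intro a
        rw [map_inv, Equiv.Perm.inv_eq_iff_eq, hg]
        simp
      rw [h1 a, h1 0]
      simp [sub_eq_add_neg]
  let c : G → (G ⧸ H) → (((G ⧸ H) × X) → ℚ) := fun g x => (ρ g (x, 0)).2
  have hc_mul : ∀ g k x, c (g * k) x = c k x + c g (k • x) := by
    intro g k x
    simp only [c]
    rw [map_mul, Equiv.Perm.mul_apply, hP k, hP g]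
    try simp
  have hc_one : ∀ x, c 1 x = 0 := by intro x; simp [c]
  have hc_gen : ∀ i x, c (b i) x = Pi.single (x, i) 1 := by
    intro i x
    simp only [c]
    rw [hρ]
    simp [twist]
  let x0 : G ⧸ H := ((1 : G) : G ⧸ H)
  have hx0 : ∀ g : G, g • x0 = (g : G ⧸ H) := by
    intro g
    simp [x0, MulAction.Quotient.smul_mk]
  have hfix : ∀ h ∈ H, h • x0 = x0 := by
    intro h hh
    rw [hx0]
    exact (QuotientGroup.eq.2 (by simpa using hh)).symm
  let U : Submodule ℚ (((G ⧸ H) × X) → ℚ) :=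
    Submodule.span ℚ (Set.range fun j => c (w j : G) x0)
  have hU : ∀ h : H, c (h : G) x0 ∈ U := by
    intro h
    have hh : h ∈ Subgroup.closure (Set.range w) := by rw [hw]; trivial
    induction hh using Subgroup.closure_induction with
    | mem g hg =>
      obtain ⟨j, rfl⟩ := hg
      exact Submodule.subset_span ⟨j, rfl⟩
    | one => simp [hc_one]
    | mul g k _ _ hg hk =>
      rw [Subgroup.coe_mul, hc_mul, hfix _ k.2]
      exact U.add_mem hk hg
    | inv g _ hg =>
      have h1 := hc_mul (g⁻¹ : G) (g : G) x0
      rw [inv_mul_cancel, hc_one, hfix _ g.2] at h1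
      have h2 : c ((g : G)⁻¹) x0 = - c (g : G) x0 := eq_neg_of_add_eq_zero_right h1.symm
      rw [Subgroup.coe_inv, h2]
      exact U.neg_mem hg
  let r : (G ⧸ H) → G := Quotient.out
  have hr : ∀ x, (r x : G ⧸ H) = x := fun x => Quotient.out_eq' x
  let W : Submodule ℚ (((G ⧸ H) × X) → ℚ) :=
    Submodule.span ℚ (Set.range fun x : {x : G ⧸ H // x ≠ x0} => c (r x) x0)
  have hUW : ∀ x, c (r x) x0 ∈ U ⊔ W := by
    intro x
    by_cases hx : x = x0
    · have h1 : r x ∈ H := by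
        have := hr x
        rw [hx] at this
        have h2 := QuotientGroup.eq.1 this.symm
        rw [hx]
        simpa using h2
      exact Submodule.mem_sup_left (hU ⟨_, h1⟩)
    · exact Submodule.mem_sup_right (Submodule.subset_span ⟨⟨x, hx⟩, rfl⟩)
  have hsingle : ∀ e : (G ⧸ H) × X, (Pi.single e 1 : ((G ⧸ H) × X) → ℚ) ∈ U ⊔ W := by
    rintro ⟨x, i⟩
    have hmem : (r (b i • x))⁻¹ * (b i * r x) ∈ H := by
      rw [← QuotientGroup.eq, hr, ← smul_eq_mul, ← MulAction.Quotient.smul_mk, hr]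
    have h1 : c (b i * r x) x0 = c (r x) x0 + Pi.single (x, i) 1 := by
      rw [hc_mul, hc_gen, hx0, hr]
    have h2 : c (b i * r x) x0 = c ((r (b i • x))⁻¹ * (b i * r x)) x0 + c (r (b i • x)) x0 := by
      have := hc_mul (r (b i • x)) ((r (b i • x))⁻¹ * (b i * r x)) x0
      rw [hfix _ hmem, mul_inv_cancel_left] at this
      exact this
    have h3 : (Pi.single (x, i) 1 : ((G ⧸ H) × X) → ℚ) =
        c ((r (b i • x))⁻¹ * (b i * r x)) x0 + c (r (b i • x)) x0 - c (r x) x0 := by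
      rw [← h2, h1]; simp
    rw [h3]
    exact Submodule.sub_mem _ (Submodule.add_mem _ (Submodule.mem_sup_left (hU ⟨_, hmem⟩))
      (hUW _)) (hUW _)
  have htop : U ⊔ W = ⊤ := by
    rw [eq_top_iff, ← (Pi.basisFun ℚ ((G ⧸ H) × X)).span_eq, Submodule.span_le]
    rintro _ ⟨e, rfl⟩
    simpa using hsingle e
  have h1 := Submodule.finrank_add_le_finrank_add_finrank U W
  rw [htop, finrank_top, Module.finrank_fintype_fun_eq_card, Fintype.card_prod] at h1
  have h2 : Module.finrank ℚ U ≤ dGroup H := by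
    have := finrank_range_le_card (R := ℚ) (fun j => c (w j : G) x0)
    rw [Fintype.card_fin] at this
    exact this
  have h3 : Module.finrank ℚ W ≤ Fintype.card (G ⧸ H) - 1 := by
    have := finrank_range_le_card (R := ℚ) (fun x : {x : G ⧸ H // x ≠ x0} => c (r x) x0)
    rw [Fintype.card_subtype_compl, Fintype.card_subtype_eq] at this
    exact this
  have h4 : 0 < Fintype.card (G ⧸ H) := Fintype.card_pos_iff.2 ⟨x0⟩
  rw [hidx]
  omega

theorem forward {G : Type*} [Group G] (hfg : Group.FG G) (hF : IsFreeGroup G)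
    (H : Subgroup G) (hH : H.FiniteIndex) :
    (dGroup ↥H : ℤ) - 1 = (H.index : ℤ) * ((dGroup G : ℤ) - 1) := by
  let b := IsFreeGroup.basis G
  have hfin : Finite (IsFreeGroup.Generators G) := by
    apply finite_of_freeGroup_fg
    exact Group.fg_of_surjective (f := b.repr.toMonoidHom) b.repr.surjective
  have : Fintype (IsFreeGroup.Generators G) := Fintype.ofFinite _
  obtain ⟨v, hv⟩ := dGroup_spec hfg
  have h1 := dGroup_upper H (closure_basis b)
  have h2 := dGroup_lower b hfg H
  have h3 := dGroup_upper (⊤ : Subgroup G) hv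
  have h4 := dGroup_lower b hfg (⊤ : Subgroup G)
  have h5 := dGroup_le_card b (closure_basis b)
  simp only [Subgroup.index_top, Fintype.card_fin] at h3 h4
  have h6 : dGroup G = Fintype.card (IsFreeGroup.Generators G) := by omega
  rw [← h6] at h1 h2
  have h7 : dGroup H + H.index = H.index * dGroup G + 1 := le_antisymm h1 h2
  zify at h7
  linarith

theorem resfin_finset {G : Type*} [Group G] (hG : ResiduallyFinite G) (F : Finset G)
    (hF : (1 : G) ∉ F) : ∃ N : Subgroup G, N.FiniteIndex ∧ ∀ g ∈ F, g ∉ N := by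
  classical
  induction F using Finset.induction_on with
  | empty => exact ⟨⊤, inferInstance, by simp⟩
  | insert a F _ ih =>
    obtain ⟨N, hN, hNF⟩ := ih fun h => hF (Finset.mem_insert_of_mem h)
    obtain ⟨M, -, hM, hMa⟩ := hG a fun h => hF (h ▸ Finset.mem_insert_self _ _)
    refine ⟨N ⊓ M, inferInstance, ?_⟩
    intro g hg hgm
    rcases Finset.mem_insert.1 hg with rfl | hg
    · exact hMa hgm.2
    · exact hNF g hg hgm.1

theorem backward {G : Type*} [Group G] (hfg : Group.FG G) (hG : ResiduallyFinite G)
    (hd : ∀ H : Subgroup G, H.FiniteIndex →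
        (dGroup ↥H : ℤ) - 1 = (H.index : ℤ) * ((dGroup G : ℤ) - 1)) : IsFreeGroup G := by
  classical
  obtain ⟨v, hv⟩ := dGroup_spec hfg
  let φ : FreeGroup (Fin (dGroup G)) →* G := FreeGroup.lift v
  have hsurj : Function.Surjective φ := by
    rw [← MonoidHom.range_eq_top, ← hv, FreeGroup.range_lift_eq_closure]
  by_cases hinj : Function.Injective φ
  · exact IsFreeGroup.ofMulEquiv (MulEquiv.ofBijective φ ⟨hinj, hsurj⟩)
  exfalso
  have hex : ∃ l : ℕ, ∃ L : List (Fin (dGroup G) × Bool), FreeGroup.IsReduced L ∧ L.length = l ∧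
      0 < l ∧ φ (FreeGroup.mk L) = 1 := by
    rw [injective_iff_map_eq_one] at hinj
    push Not at hinj
    obtain ⟨a, ha, ha1⟩ := hinj
    refine ⟨_, a.toWord, FreeGroup.isReduced_toWord, rfl, ?_, by rw [FreeGroup.mk_toWord, ha]⟩
    rw [List.length_pos_iff]
    simpa [FreeGroup.toWord_eq_nil_iff] using ha1
  obtain ⟨L, hred, hlen, hpos, hL1⟩ := Nat.find_spec hex
  have hmin : ∀ L' : List (Fin (dGroup G) × Bool), FreeGroup.IsReduced L' → 0 < L'.length →
      φ (FreeGroup.mk L') = 1 → L.length ≤ L'.length := by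
    intro L' h1 h2 h3
    rw [hlen]
    exact Nat.find_min' hex ⟨L', h1, rfl, h2, h3⟩
  rw [← hlen] at hpos
  clear hlen
  set l := L.length with hl
  let p : ℕ → G := fun j => φ (FreeGroup.mk (L.drop j))
  have hp0 : p 0 = 1 := by simpa [p] using hL1
  have hpl : p l = 1 := by
    simp only [p, hl, List.drop_length, ← FreeGroup.one_eq_mk, map_one]
  have hp_lt : ∀ j k, j < k → k < l → p j ≠ p k := by
    intro j k hjk hk heq
    have hsplit : L.drop j = (L.drop j).take (k - j) ++ L.drop k := by
      have := (List.take_append_drop (k - j) (L.drop j)).symm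
      rwa [List.drop_drop, Nat.add_sub_cancel' hjk.le] at this
    have h1 : p j = φ (FreeGroup.mk ((L.drop j).take (k - j))) * p k := by
      simp only [p]
      rw [← map_mul, FreeGroup.mul_mk, ← hsplit]
    rw [← heq, eq_comm, mul_eq_right] at h1
    have hlen' : ((L.drop j).take (k - j)).length = k - j := by
      rw [List.length_take, List.length_drop]; omega
    have := hmin _ (hred.infix
      ((List.take_prefix _ _).isInfix.trans (List.drop_suffix _ _).isInfix)) (by omega) h1
    omega
  have hp_ne : ∀ j k, j < l → k < l → p j = p k → j = k := by
    intro j k hj hk h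
    rcases lt_trichotomy j k with h1 | h1 | h1
    · exact absurd h (hp_lt j k h1 hk)
    · exact h1
    · exact absurd h.symm (hp_lt k j h1 hj)
  obtain ⟨N, hN, hNF⟩ := resfin_finset hG
    (((Finset.univ : Finset (Fin l × Fin l)).image fun a => (p a.1)⁻¹ * p a.2).erase 1) (by simp)
  let q : ℕ → G ⧸ N := fun j => (p j : G ⧸ N)
  have hq_ne : ∀ j k, j < l → k < l → q j = q k → j = k := by
    intro j k hj hk h
    have h1 : (p j)⁻¹ * p k ∈ N := QuotientGroup.eq.1 h
    apply hp_ne j k hj hk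
    by_contra hne
    refine hNF _ ?_ h1
    rw [Finset.mem_erase]
    refine ⟨fun h2 => hne (inv_mul_eq_one.1 h2), ?_⟩
    rw [Finset.mem_image]
    exact ⟨(⟨j, hj⟩, ⟨k, hk⟩), Finset.mem_univ _, rfl⟩
  have hql : q l = q 0 := by simp only [q, hpl, hp0]
  have hq_ne' : ∀ j k, j ≤ l → k ≤ l → q j = q k →
      j = k ∨ (j = 0 ∧ k = l) ∨ (j = l ∧ k = 0) := by
    intro j k hj hk h
    rcases hj.lt_or_eq with hj | rfl <;> rcases hk.lt_or_eq with hk | rfl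
    · exact Or.inl (hq_ne j k hj hk h)
    · rw [hql] at h
      exact Or.inr (Or.inl ⟨hq_ne j 0 hj hpos h, rfl⟩)
    · rw [hql] at h
      exact Or.inr (Or.inr ⟨rfl, (hq_ne 0 k hpos hk h).symm⟩)
    · exact Or.inl rfl
  let q' : Fin l → G ⧸ N := fun j => q j
  have hq' : Function.Injective q' := fun j k h => Fin.ext (hq_ne j k j.2 k.2 h)
  let t : G ⧸ N → G := Function.extend q' (fun j => p j) 1
  have ht_lt : ∀ j, j < l → t (q j) = p j := fun j hj => hq'.extend_apply _ _ ⟨j, hj⟩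
  have ht : ∀ j, j ≤ l → t (q j) = p j := by
    intro j hj
    rcases hj.lt_or_eq with hj | rfl
    · exact ht_lt j hj
    · rw [hql, ht_lt 0 hpos, hp0, hpl]
  let S : Finset (G ⧸ N) := Finset.univ.image q'
  have hS : ∀ j, j ≤ l → q j ∈ S := by
    intro j hj
    rcases hj.lt_or_eq with hj | rfl
    · exact Finset.mem_image.2 ⟨⟨j, hj⟩, Finset.mem_univ _, rfl⟩
    · rw [hql]
      exact Finset.mem_image.2 ⟨⟨0, hpos⟩, Finset.mem_univ _, rfl⟩
  have hstep : ∀ j (hj : j < l), p j = φ (FreeGroup.mk [L[j]]) * p (j + 1) := by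
    intro j hj
    simp only [p]
    rw [← map_mul, FreeGroup.mul_mk, List.singleton_append, List.drop_eq_getElem_cons hj]
  have hstep_t : ∀ j (hj : j < l), L[j].2 = true → p j = v L[j].1 * p (j + 1) := by
    intro j hj hb
    rw [hstep j hj]
    simp [φ, hb]
  have hstep_f : ∀ j (hj : j < l), L[j].2 = false → p (j + 1) = v L[j].1 * p j := by
    intro j hj hb
    rw [hstep j hj]
    simp [φ, hb]
  have hq_t : ∀ j (hj : j < l), L[j].2 = true → q j = v L[j].1 • q (j + 1) := by
    intro j hj hb
    simp only [q]
    rw [MulAction.Quotient.smul_mk, smul_eq_mul, ← hstep_t j hj hb]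
  have hq_f : ∀ j (hj : j < l), L[j].2 = false → q (j + 1) = v L[j].1 • q j := by
    intro j hj hb
    simp only [q]
    rw [MulAction.Quotient.smul_mk, smul_eq_mul, ← hstep_f j hj hb]
  let E : Fin l → (G ⧸ N) × Fin (dGroup G) := fun j =>
    (if L[(j : ℕ)].2 = true then q (j + 1) else q j, L[(j : ℕ)].1)
  have hEt : ∀ j : Fin l, L[(j : ℕ)].2 = true → E j = (q (j + 1), L[(j : ℕ)].1) := by
    intro j hb; simp [E, hb]
  have hEf : ∀ j : Fin l, L[(j : ℕ)].2 = false → E j = (q j, L[(j : ℕ)].1) := by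
    intro j hb; simp [E, hb]
  have hchain : ∀ i (hi : i + 1 < l), L[i].1 = L[i + 1].1 → L[i].2 = L[i + 1].2 := by
    intro i hi
    exact List.isChain_iff_getElem.1 hred i hi
  have hmixed : ∀ j k : Fin l, L[(j : ℕ)].2 = true → L[(k : ℕ)].2 = false → E j ≠ E k := by
    intro j k hj hk h
    rw [hEt j hj, hEf k hk, Prod.mk.injEq] at h
    obtain ⟨h1, h2⟩ := h
    have h3 : q j = q (k + 1) := by
      rw [hq_t j j.2 hj, hq_f k k.2 hk, h1, h2]
    have hj2 := j.2
    have hk2 := k.2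
    have hjk : (j : ℕ) ≠ k := by
      intro h
      simp only [h] at hj
      rw [hk] at hj
      cases hj
    have hA := hq_ne' _ _ (by omega) (by omega) h1
    have hB := hq_ne' _ _ (by omega) (by omega) h3
    have hcase : ((j : ℕ) = 0 ∧ (k : ℕ) = 1) ∨ ((j : ℕ) = 1 ∧ (k : ℕ) = 0) := by omega
    rcases hcase with ⟨h4, h5⟩ | ⟨h4, h5⟩
    · simp only [h4, h5] at hj hk h2
      have := hchain 0 (by omega) h2
      rw [hj, hk] at this
      cases this
    · simp only [h4, h5] at hj hk h2
      have := hchain 0 (by omega) h2.symm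
      rw [hj, hk] at this
      cases this
  have hE : Function.Injective E := by
    intro j k h
    have hj2 := j.2
    have hk2 := k.2
    apply Fin.ext
    rcases hj : L[(j : ℕ)].2 with _ | _ <;> rcases hk : L[(k : ℕ)].2 with _ | _
    · rw [hEf j hj, hEf k hk, Prod.mk.injEq] at h
      exact hq_ne _ _ hj2 hk2 h.1
    · exact absurd h.symm (hmixed k j hk hj)
    · exact absurd h (hmixed j k hj hk)
    · rw [hEt j hj, hEt k hk, Prod.mk.injEq] at h
      have := hq_ne' _ _ (by omega) (by omega) h.1
      omega
  have hq0 : q 0 = ((1 : G) : G ⧸ N) := by simp only [q, hp0]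
  have hSch : Sch N v S (Finset.univ.image E) t := by
    refine ⟨hq0 ▸ hS 0 (by omega), ?_, ?_, ?_, ?_, ?_⟩
    · rw [← hq0, ht 0 (by omega), hp0]
    · intro x hx
      obtain ⟨j, -, rfl⟩ := Finset.mem_image.1 hx
      change ((t (q j) : G) : G ⧸ N) = q j
      rw [ht j j.2.le]
    all_goals
      intro e he
      obtain ⟨j, -, rfl⟩ := Finset.mem_image.1 he
      have hj2 := j.2
      rcases hj : L[(j : ℕ)].2 with _ | _
    · rw [hEf j hj]; exact hS _ (by omega)
    · rw [hEt j hj]; exact hS _ (by omega)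
    · rw [hEf j hj]; simp only; rw [← hq_f j j.2 hj]; exact hS _ (by omega)
    · rw [hEt j hj]; simp only; rw [← hq_t j j.2 hj]; exact hS _ (by omega)
    · rw [hEf j hj]; simp only
      rw [← hq_f j j.2 hj, ht _ (by omega), ht _ (by omega), hstep_f j j.2 hj]
    · rw [hEt j hj]; simp only
      rw [← hq_t j j.2 hj, ht _ (by omega), ht _ (by omega), hstep_t j j.2 hj]
  have hb := hSch.bound hv
  rw [Finset.card_image_of_injective _ hE, Finset.card_image_of_injective _ hq',
    Fintype.card_fin] at hb
  have h1 := hd N hN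
  have h2 : dGroup N + N.index ≤ N.index * dGroup G := by omega
  zify at h2
  linarith

theorem stmt_3 {G : Type*} [Group G] (hfg : Group.FG G) (hG : ResiduallyFinite G) :
    IsFreeGroup G ↔
      ∀ H : Subgroup G, H.FiniteIndex →
        (dGroup ↥H : ℤ) - 1 = (H.index : ℤ) * ((dGroup G : ℤ) - 1) :=
  ⟨fun hF H hH => forward hfg hF H hH, backward hfg hG⟩
end

section
/- Let G be a group admitting a finite presentation with n generators and m relators (that is, G is isomorphic to F/N where F is a free group of rank n and N is the normal closure of a set of m elements of F), and let H be a subgroup of G of finite index k. Then H admits a finite presentation with k·(n − 1) + 1 generators and k·m relators. In particular, if G has a presentation with n generators and m relators, then H has a presentation with n' generators and m' relators satisfying (n' − m') − 1 ≥ k·((n − m) − 1). -/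
/-- `G` has a finite presentation with `n` generators and `m` relators:
`G ≅ F/N` where `F` is free of rank `n` and `N` is the normal closure of a set of
`m` elements of `F` (given as the range of a family indexed by `Fin m`). -/
def HasPresentation (G : Type*) [Group G] (n m : ℕ) : Prop :=
  ∃ rel : Fin m → FreeGroup (Fin n),
    Nonempty (G ≃* (FreeGroup (Fin n) ⧸ Subgroup.normalClosure (Set.range rel)))

namespace SchreierIndex

open Function

/-- 1-cocycles of `F` with values in functions on `F ⧸ K`. -/
def Cocycle {F : Type} [Group F] (K : Subgroup F) (A : Type) [CommGroup A] : Type :=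
  {z : F → F ⧸ K → A // ∀ g h q, z (g * h) q = z g q * z h (g⁻¹ • q)}

/-- A section of `F → F ⧸ K` with value `1` at the base point. -/
noncomputable def sec {F : Type} [Group F] (K : Subgroup F) (q : F ⧸ K) : F :=
  Quotient.out q * (Quotient.out ((1 : F) : F ⧸ K))⁻¹

lemma out_one_mem {F : Type} [Group F] (K : Subgroup F) :
    Quotient.out ((1 : F) : F ⧸ K) ∈ K := by
  have h : ((Quotient.out ((1 : F) : F ⧸ K) : F) : F ⧸ K) = ((1 : F) : F ⧸ K) :=
    Quotient.out_eq _
  have := QuotientGroup.eq.mp h.symm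
  simpa using this

lemma sec_one {F : Type} [Group F] (K : Subgroup F) : sec K ((1 : F) : F ⧸ K) = 1 := by
  simp [sec]

lemma sec_mk {F : Type} [Group F] (K : Subgroup F) (q : F ⧸ K) :
    ((sec K q : F) : F ⧸ K) = q := by
  have h : ((Quotient.out q : F) : F ⧸ K) = q := Quotient.out_eq _
  conv_rhs => rw [← h]
  rw [QuotientGroup.eq]
  simpa [sec] using out_one_mem K

lemma sec_inv_smul {F : Type} [Group F] (K : Subgroup F) (q : F ⧸ K) :
    (sec K q)⁻¹ • q = ((1 : F) : F ⧸ K) := by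
  rw [inv_smul_eq_iff]
  conv_lhs => rw [← sec_mk K q]
  simp [MulAction.Quotient.smul_mk]

lemma mem_aux {F : Type} [Group F] (K : Subgroup F) (g : F) (q : F ⧸ K) :
    (sec K q)⁻¹ * g * sec K (g⁻¹ • q) ∈ K := by
  have h : ((sec K q : F) : F ⧸ K) = ((g * sec K (g⁻¹ • q) : F) : F ⧸ K) := by
    have : ((g * sec K (g⁻¹ • q) : F) : F ⧸ K) = g • ((sec K (g⁻¹ • q) : F) : F ⧸ K) := rfl
    rw [this, sec_mk, sec_mk, smul_inv_smul]
  have := QuotientGroup.eq.mp h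
  simpa [mul_assoc] using this

lemma inv_smul_one {F : Type} [Group F] (K : Subgroup F) (g : K) :
    (g : F)⁻¹ • ((1 : F) : F ⧸ K) = ((1 : F) : F ⧸ K) := by
  have : (g : F)⁻¹ • ((1 : F) : F ⧸ K) = (((g : F)⁻¹ * 1 : F) : F ⧸ K) := rfl
  rw [this, QuotientGroup.eq]
  simp

lemma Cocycle.map_one {F : Type} [Group F] {K : Subgroup F} {A : Type} [CommGroup A]
    (z : Cocycle K A) (q : F ⧸ K) : z.1 1 q = 1 := by
  have := z.2 1 1 q
  simpa using this

/-- The Shapiro lemma at the level of cocycles. -/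
noncomputable def shapiro {F : Type} [Group F] (K : Subgroup F) (A : Type) [CommGroup A] :
    Cocycle K A × A ≃ (K →* A) × (F ⧸ K → A) where
  toFun p := (⟨⟨fun g => p.1.1 g ((1 : F) : F ⧸ K), p.1.map_one _⟩, fun g h => by
      have := p.1.2 g h ((1 : F) : F ⧸ K)
      rw [inv_smul_one] at this
      exact this⟩, fun q => p.1.1 (sec K q) q * p.2)
  invFun p := (⟨fun g q => p.2 q * p.1 ⟨_, mem_aux K g q⟩ * (p.2 (g⁻¹ • q))⁻¹, by
      intro g h q
      have : (⟨_, mem_aux K (g * h) q⟩ : K) =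
          ⟨_, mem_aux K g q⟩ * ⟨_, mem_aux K h (g⁻¹ • q)⟩ := by
        ext
        simp [mul_assoc, mul_smul]
      beta_reduce
      rw [this, _root_.map_mul, mul_inv_rev, mul_smul]
      simp only [mul_assoc]
      rw [inv_mul_cancel_left]⟩, p.2 ((1 : F) : F ⧸ K))
  left_inv := by
    rintro ⟨z, a⟩
    refine Prod.ext (Subtype.ext ?_) ?_
    · funext g q
      have h1 := z.2 g (sec K (g⁻¹ • q)) q
      have h2 := z.2 (sec K q) ((sec K q)⁻¹ * g * sec K (g⁻¹ • q)) q
      rw [sec_inv_smul] at h2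
      have h3 : sec K q * ((sec K q)⁻¹ * g * sec K (g⁻¹ • q)) = g * sec K (g⁻¹ • q) := by group
      rw [h3, h1] at h2
      change z.1 (sec K q) q * a * z.1 ((sec K q)⁻¹ * g * sec K (g⁻¹ • q)) ((1 : F) : F ⧸ K) *
        (z.1 (sec K (g⁻¹ • q)) (g⁻¹ • q) * a)⁻¹ = z.1 g q
      rw [mul_inv_eq_iff_eq_mul, ← mul_assoc, h2]
      exact mul_right_comm _ _ _
    · change z.1 (sec K ((1 : F) : F ⧸ K)) _ * a = a
      rw [sec_one, z.map_one, one_mul]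
  right_inv := by
    rintro ⟨f, c⟩
    refine Prod.ext (MonoidHom.ext fun g => ?_) (funext fun q => ?_)
    · change c ((1 : F) : F ⧸ K) * f ⟨_, mem_aux K g ((1 : F) : F ⧸ K)⟩ *
        (c ((g : F)⁻¹ • ((1 : F) : F ⧸ K)))⁻¹ = f g
      have : (⟨_, mem_aux K g ((1 : F) : F ⧸ K)⟩ : K) = g := by
        ext
        simp only [inv_smul_one, sec_one]
        simp
      rw [this, inv_smul_one, mul_comm (c _), mul_inv_cancel_right]
    · change c q * f ⟨_, mem_aux K (sec K q) q⟩ * (c ((sec K q)⁻¹ • q))⁻¹ *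
        c ((1 : F) : F ⧸ K) = c q
      have : (⟨_, mem_aux K (sec K q) q⟩ : K) = 1 := by
        ext
        simp only [sec_inv_smul, sec_one]
        simp
      rw [this, sec_inv_smul, _root_.map_one, mul_one, inv_mul_cancel_right]

/-- The homomorphism to the wreath product associated with a cocycle. -/
def toWreath {F : Type} [Group F] {K : Subgroup F} {A : Type} [CommGroup A]
    (z : Cocycle K A) : F →* (F ⧸ K → A) ⋊[mulAutArrow] F where
  toFun g := ⟨z.1 g, g⟩
  map_one' := by
    ext q
    · exact z.map_one q
    · rfl
  map_mul' g h := by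
    ext q
    · exact z.2 g h q
    · rfl

lemma restrict_bijective {n : ℕ} (K : Subgroup (FreeGroup (Fin n))) (A : Type) [CommGroup A] :
    Bijective (fun (z : Cocycle K A) (i : Fin n) => z.1 (FreeGroup.of i)) := by
  constructor
  · intro z w h
    have : toWreath z = toWreath w := by
      apply FreeGroup.ext_hom
      intro i
      have := congrFun h i
      refine SemidirectProduct.ext ?_ rfl
      exact this
    apply Subtype.ext
    funext g
    exact congrArg SemidirectProduct.left (DFunLike.congr_fun this g)
  · intro c
    let f : FreeGroup (Fin n) →* (FreeGroup (Fin n) ⧸ K → A) ⋊[mulAutArrow] FreeGroup (Fin n) :=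
      FreeGroup.lift fun i => ⟨c i, FreeGroup.of i⟩
    have hf : ∀ g, (f g).right = g := by
      have : SemidirectProduct.rightHom.comp f = MonoidHom.id _ := by
        apply FreeGroup.ext_hom
        intro i
        simp [f]
      exact DFunLike.congr_fun this
    refine ⟨⟨fun g => (f g).left, ?_⟩, ?_⟩
    · intro g h q
      beta_reduce
      rw [_root_.map_mul, SemidirectProduct.mul_left, hf]
      rfl
    · funext i
      simp [f]

lemma rank_formula {n : ℕ} (K : Subgroup (FreeGroup (Fin n))) (hK : K.index ≠ 0) :
    ∃ d : ℕ, n * K.index + 1 = d + K.index ∧ Nonempty (K ≃* FreeGroup (Fin d)) := by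
  let A := Multiplicative (ZMod 2)
  have hA : Nat.card A = 2 := by simp [A]
  have : Finite A := inferInstanceAs (Finite (ZMod 2))
  have : Nontrivial A := inferInstanceAs (Nontrivial (ZMod 2))
  let b := IsFreeGroup.basis K
  have : K.FiniteIndex := ⟨hK⟩
  have : Finite (FreeGroup (Fin n) ⧸ K) := inferInstance
  have hQ : Nat.card (FreeGroup (Fin n) ⧸ K) = K.index := rfl
  have h1 := Nat.card_congr (shapiro K A)
  have h2 := Nat.card_congr (Equiv.ofBijective _ (restrict_bijective K A))
  have h3 : Nat.card (IsFreeGroup.Generators K → A) = Nat.card (K →* A) :=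
    Nat.card_congr b.lift
  have hfun : ∀ (α β : Type) [Finite α], Nat.card (α → β) = Nat.card β ^ Nat.card α := by
    intro α β _
    exact Nat.card_fun
  rw [Nat.card_prod, Nat.card_prod, h2, ← h3, hfun (Fin n), hfun (FreeGroup (Fin n) ⧸ K), hA, hQ,
    Nat.card_fin, ← pow_mul] at h1
  have hfin : Finite (IsFreeGroup.Generators K) := by
    by_contra hinf
    rw [not_finite_iff_infinite] at hinf
    have : Infinite (IsFreeGroup.Generators K → A) := inferInstance
    rw [Nat.card_eq_zero_of_infinite, zero_mul] at h1
    simp at h1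
  rw [hfun (IsFreeGroup.Generators K), hA, ← pow_succ, ← pow_add] at h1
  have h4 := Nat.pow_right_injective le_rfl h1
  refine ⟨Nat.card (IsFreeGroup.Generators K), ?_, ?_⟩
  · rw [← h4]; ring
  · exact ⟨(b.reindex (Finite.equivFin _)).repr⟩

lemma main {G : Type*} [Group G] {n m : ℕ} (hG : HasPresentation G n m)
    (H : Subgroup G) (hk0 : H.index ≠ 0) :
    ∃ d : ℕ, n * H.index + 1 = d + H.index ∧ HasPresentation H d (H.index * m) := by
  obtain ⟨rel, ⟨e⟩⟩ := hG
  let φ : FreeGroup (Fin n) →* G := e.symm.toMonoidHom.comp (QuotientGroup.mk' _)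
  have hφ : Surjective φ := e.symm.surjective.comp (QuotientGroup.mk'_surjective _)
  have hker : ∀ x, φ x = 1 ↔ x ∈ Subgroup.normalClosure (Set.range rel) := by
    intro x
    simp [φ]
  let K := H.comap φ
  have hidx : K.index = H.index := Subgroup.index_comap_of_surjective H hφ
  have : K.FiniteIndex := ⟨by rw [hidx]; exact hk0⟩
  obtain ⟨d, hd, ⟨ε⟩⟩ := rank_formula K (by rw [hidx]; exact hk0)
  rw [hidx] at hd
  refine ⟨d, hd, ?_⟩
  have hcard : Nat.card ((FreeGroup (Fin n) ⧸ K) × Fin m) = H.index * m := by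
    rw [Nat.card_prod, Nat.card_fin, ← hidx]; rfl
  let ι : Fin (H.index * m) ≃ (FreeGroup (Fin n) ⧸ K) × Fin m :=
    (Finite.equivFinOfCardEq hcard).symm
  have hrel : ∀ (g : FreeGroup (Fin n)) (i : Fin m), φ (g⁻¹ * rel i * g) = 1 := by
    intro g i
    have : φ (rel i) = 1 := (hker _).2 (Subgroup.subset_normalClosure ⟨i, rfl⟩)
    simp [this]
  let r : (FreeGroup (Fin n) ⧸ K) × Fin m → K := fun p =>
    ⟨(sec K p.1)⁻¹ * rel p.2 * sec K p.1, by
      change φ _ ∈ H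
      rw [hrel]; exact H.one_mem⟩
  refine ⟨fun j => ε (r (ι j)), ?_⟩
  let ψ : FreeGroup (Fin d) →* H := (φ.subgroupComap H).comp ε.symm.toMonoidHom
  have hψ : Surjective ψ :=
    (MonoidHom.subgroupComap_surjective_of_surjective φ H hφ).comp ε.symm.surjective
  have hψval : ∀ x, (ψ x : G) = φ (ε.symm x : K) := fun x => rfl
  have hkerψ : ψ.ker = Subgroup.normalClosure (Set.range fun j => ε (r (ι j))) := by
    apply le_antisymm
    · intro x hx
      let θ : FreeGroup (Fin d) →* FreeGroup (Fin n) := K.subtype.comp ε.symm.toMonoidHom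
      have hθ : Injective θ := Subtype.val_injective.comp ε.symm.injective
      have key : Subgroup.normalClosure (Set.range rel) ≤
          (Subgroup.normalClosure (Set.range fun j => ε (r (ι j)))).map θ := by
        rw [Subgroup.normalClosure, Subgroup.closure_le]
        intro y hy
        obtain ⟨a, ⟨i, rfl⟩, hc⟩ := Group.mem_conjugatesOfSet_iff.1 hy
        obtain ⟨g, rfl⟩ := isConj_iff.1 hc
        let q : FreeGroup (Fin n) ⧸ K := ((g⁻¹ : FreeGroup (Fin n)) : FreeGroup (Fin n) ⧸ K)
        have hkm : g * sec K q ∈ K := by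
          have := QuotientGroup.eq.mp (sec_mk K q).symm
          simpa using this
        let k : K := ⟨_, hkm⟩
        refine ⟨ε k * ε (r (q, i)) * (ε k)⁻¹, ?_, ?_⟩
        · have hm : ε (r (q, i)) ∈ Subgroup.normalClosure (Set.range fun j => ε (r (ι j))) :=
            Subgroup.subset_normalClosure ⟨ι.symm (q, i), by simp⟩
          exact Subgroup.normalClosure_normal.conj_mem _ hm _
        · simp [θ, k, r, mul_assoc]
      have hx1 : θ x ∈ Subgroup.normalClosure (Set.range rel) := by
        rw [← hker]
        have : (ψ x : G) = 1 := by
          rw [MonoidHom.mem_ker.1 hx]; rfl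
        exact this
      obtain ⟨y, hy, hyx⟩ := key hx1
      rwa [← hθ hyx]
    · apply Subgroup.normalClosure_le_normal
      rintro _ ⟨j, rfl⟩
      refine MonoidHom.mem_ker.2 (Subtype.ext ?_)
      rw [hψval]
      simp only [MulEquiv.symm_apply_apply]
      exact hrel _ _
  exact ⟨((QuotientGroup.quotientMulEquivOfEq hkerψ.symm).trans
    (QuotientGroup.quotientKerEquivOfSurjective ψ hψ)).symm⟩

end SchreierIndex

theorem stmt_4 {G : Type*} [Group G] {n m : ℕ} (hG : HasPresentation G n m)
    (H : Subgroup G) (k : ℕ) (hk : H.index = k) (hk0 : k ≠ 0) :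
    (∃ n' : ℕ, (n' : ℤ) = (k : ℤ) * ((n : ℤ) - 1) + 1 ∧ HasPresentation ↥H n' (k * m)) ∧
      ∃ n' m' : ℕ, HasPresentation ↥H n' m' ∧
        (k : ℤ) * (((n : ℤ) - (m : ℤ)) - 1) ≤ ((n' : ℤ) - (m' : ℤ)) - 1 := by
  subst hk
  obtain ⟨d, hd, hp⟩ := SchreierIndex.main hG H hk0
  have hd' : (n : ℤ) * (H.index : ℤ) + 1 = d + H.index := by exact_mod_cast hd
  refine ⟨⟨d, by linarith, hp⟩, d, _, hp, ?_⟩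
  push_cast
  linarith
end

section
/- Let G be a group with a finite presentation having e₁ generators and e₂ relators. Then e₁ − e₂ ≤ b₁(G) − b₂(G), where b_i(G) = dim_ℚ H_i(G, ℚ) denotes the i-th rational Betti number of G (the dimension over ℚ of the i-th group homology of G with trivial coefficients ℚ). -/
/-! Group homology `H_i(G, ℚ)` with trivial rational coefficients, defined via the
standard complex of inhomogeneous chains, and the Betti numbers `b_i(G)`. -/

/-- The space of inhomogeneous `n`-chains of `G` with trivial coefficients `ℚ`. -/
abbrev inhomogChains (G : Type*) [Group G] (n : ℕ) : Type _ := (Fin n → G) →₀ ℚ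

/-- The standard differential on inhomogeneous chains (trivial coefficients):
`∂(g₁,…,g_{n+1}) = (g₂,…,g_{n+1}) + ∑_{j=1}^{n} (−1)^j (g₁,…,g_j g_{j+1},…,g_{n+1})
  + (−1)^{n+1} (g₁,…,g_n)`. -/
noncomputable def chainsD (G : Type*) [Group G] (n : ℕ) :
    inhomogChains G (n + 1) →ₗ[ℚ] inhomogChains G n :=
  Finsupp.lift (inhomogChains G n) ℚ (Fin (n + 1) → G) fun g =>
    Finsupp.single (fun i => g i.succ) (1 : ℚ) +
      ∑ j : Fin (n + 1),
        (-1 : ℚ) ^ ((j : ℕ) + 1) • Finsupp.single (Fin.contractNth j (· * ·) g) (1 : ℚ)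

/-- The `n`-cycles: all of `ℚ[G⁰]` in degree `0`, and `ker ∂ₙ` in degree `n ≥ 1`. -/
noncomputable def grpCycles (G : Type*) [Group G] : (n : ℕ) → Submodule ℚ (inhomogChains G n)
  | 0 => ⊤
  | (n + 1) => LinearMap.ker (chainsD G n)

/-- The `n`-th group homology `H_n(G, ℚ)` of `G` with trivial coefficients `ℚ`:
the quotient of the `n`-cycles by the `n`-boundaries. -/
noncomputable abbrev grpHomology (G : Type*) [Group G] (n : ℕ) : Type _ :=
  ↥(grpCycles G n) ⧸
    Submodule.comap (grpCycles G n).subtype (LinearMap.range (chainsD G n))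

/-- `b_i(G) = dim_ℚ H_i(G, ℚ)`, the `i`-th rational Betti number of `G`. -/
noncomputable def bettiNumber (G : Type*) [Group G] (i : ℕ) : ℕ :=
  Module.finrank ℚ (grpHomology G i)

/-- The dimension count. -/
theorem dim_count {W D R H : Type*} [AddCommGroup W] [Module ℚ W] [AddCommGroup D] [Module ℚ D]
    [AddCommGroup R] [Module ℚ R] [AddCommGroup H] [Module ℚ H]
    [FiniteDimensional ℚ R] [FiniteDimensional ℚ H]
    (p : W →ₗ[ℚ] D) (ρ : W →ₗ[ℚ] R) (ι : H →ₗ[ℚ] W)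
    (hp : Function.Surjective p) (hk : LinearMap.ker ρ ≤ LinearMap.ker p)
    (hι : ∀ x, p (ι x) = 0) :
    Module.finrank ℚ D + Module.finrank ℚ H ≤
      Module.finrank ℚ R + Module.finrank ℚ (LinearMap.ker (ρ ∘ₗ ι)) := by
  let q : LinearMap.range ρ →ₗ[ℚ] D :=
    ((LinearMap.ker ρ).liftQ p hk) ∘ₗ ρ.quotKerEquivRange.symm.toLinearMap
  have hq : ∀ w, q ⟨ρ w, LinearMap.mem_range_self ρ w⟩ = p w := by
    intro w
    have : ρ.quotKerEquivRange.symm ⟨ρ w, LinearMap.mem_range_self ρ w⟩ =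
        (LinearMap.ker ρ).mkQ w := by
      rw [LinearEquiv.symm_apply_eq]
      rfl
    simp only [q, LinearMap.comp_apply, LinearEquiv.coe_coe, this]
    rfl
  have hqs : Function.Surjective q := by
    intro d
    obtain ⟨w, rfl⟩ := hp d
    exact ⟨_, hq w⟩
  have h1 := LinearMap.finrank_range_add_finrank_ker q
  rw [LinearMap.range_eq_top.2 hqs, finrank_top] at h1
  have h2 := LinearMap.finrank_range_add_finrank_ker (ρ ∘ₗ ι)
  have h3 : Module.finrank ℚ (LinearMap.range ρ) ≤ Module.finrank ℚ R := Submodule.finrank_le _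
  have h4 : Module.finrank ℚ (LinearMap.range (ρ ∘ₗ ι)) ≤ Module.finrank ℚ (LinearMap.ker q) := by
    have hle : LinearMap.range (ρ ∘ₗ ι) ≤ (LinearMap.ker q).map (LinearMap.range ρ).subtype := by
      rintro _ ⟨x, rfl⟩
      refine ⟨⟨ρ (ι x), LinearMap.mem_range_self ρ _⟩, ?_, rfl⟩
      simp [hq, hι]
    exact (Submodule.finrank_mono hle).trans (Submodule.finrank_map_le _ _)
  omega

theorem chainsD_one {G : Type*} [Group G] (g : Fin 2 → G) :
    chainsD G 1 (Finsupp.single g 1) =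
      Finsupp.single ![g 1] 1 - Finsupp.single ![g 0 * g 1] 1 + Finsupp.single ![g 0] 1 := by
  have e1 : (fun i : Fin 1 => g i.succ) = ![g 1] := by
    ext i; fin_cases i; rfl
  have e2 : Fin.contractNth 0 (· * ·) g = ![g 0 * g 1] := by
    ext i; fin_cases i; rfl
  have e3 : Fin.contractNth 1 (· * ·) g = ![g 0] := by
    ext i; fin_cases i; rfl
  simp [chainsD, Fin.sum_univ_two, e1, e2, e3]
  abel

theorem chainsD_two {G : Type*} [Group G] (g : Fin 3 → G) :
    chainsD G 2 (Finsupp.single g 1) =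
      Finsupp.single ![g 1, g 2] 1 - Finsupp.single ![g 0 * g 1, g 2] 1
        + Finsupp.single ![g 0, g 1 * g 2] 1 - Finsupp.single ![g 0, g 1] 1 := by
  have e1 : (fun i : Fin 2 => g i.succ) = ![g 1, g 2] := by
    ext i; fin_cases i <;> rfl
  have e2 : Fin.contractNth 0 (· * ·) g = ![g 0 * g 1, g 2] := by
    ext i; fin_cases i <;> rfl
  have e3 : Fin.contractNth 1 (· * ·) g = ![g 0, g 1 * g 2] := by
    ext i; fin_cases i <;> rfl
  have e4 : Fin.contractNth 2 (· * ·) g = ![g 0, g 1] := by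
    ext i; fin_cases i <;> rfl
  have e5 : (-1 : ℚ) ^ 3 = -1 := by norm_num
  simp [chainsD, Fin.sum_univ_three, e1, e2, e3, e4, e5]
  abel

theorem chainsD_zero {G : Type*} [Group G] : chainsD G 0 = 0 := by
  ext g : 2
  have e : (fun i : Fin 0 => g i.succ) = Fin.contractNth 0 (· * ·) g := Subsingleton.elim _ _
  simp [chainsD, e]

theorem chainsD_comp {G : Type*} [Group G] (x : inhomogChains G 3) :
    chainsD G 1 (chainsD G 2 x) = 0 := by
  have hb : ∀ g : Fin 3 → G, chainsD G 1 (chainsD G 2 (Finsupp.single g 1)) = 0 := by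
    intro g
    rw [chainsD_two]
    refine (map_sub (chainsD G 1) _ _).trans ?_
    rw [map_add, map_sub, chainsD_one, chainsD_one, chainsD_one, chainsD_one]
    simp [mul_assoc]
    abel
  have : chainsD G 1 ∘ₗ chainsD G 2 = 0 := by
    apply Finsupp.lhom_ext'
    intro g
    refine LinearMap.ext_ring ?_
    exact hb g
  exact LinearMap.congr_fun this x

/-- The central extension of `G` by `ℚ` attached to a function on pairs. -/
@[ext] structure CExt (G : Type*) (f : G → G → ℚ) where
  q : ℚ
  g : G

/-- The group structure, for a cocycle. -/
@[reducible] def CExt.group {G : Type*} [Group G] (f : G → G → ℚ)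
    (hf : ∀ a b c, f b c - f (a * b) c + f a (b * c) - f a b = 0) : Group (CExt G f) :=
  letI : Mul (CExt G f) := ⟨fun x y => ⟨x.q + y.q - f x.g y.g, x.g * y.g⟩⟩
  letI : One (CExt G f) := ⟨⟨f 1 1, 1⟩⟩
  letI : Inv (CExt G f) := ⟨fun x => ⟨-x.q + f 1 1 + f x.g⁻¹ x.g, x.g⁻¹⟩⟩
  Group.ofLeftAxioms
    (by
      intro x y z
      have := hf x.g y.g z.g
      ext
      · change (x.q + y.q - f x.g y.g) + z.q - f (x.g * y.g) z.g =
          x.q + (y.q + z.q - f y.g z.g) - f x.g (y.g * z.g)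
        linarith
      · exact mul_assoc _ _ _)
    (by
      intro x
      have := hf 1 1 x.g
      simp only [one_mul] at this
      ext
      · change f 1 1 + x.q - f 1 x.g = x.q
        linarith
      · exact one_mul _)
    (by
      intro x
      ext
      · change (-x.q + f 1 1 + f x.g⁻¹ x.g) + x.q - f x.g⁻¹ x.g = f 1 1
        ring
      · exact inv_mul_cancel _)

/-- A cocycle pulled back to a free group is a coboundary. -/
theorem exists_cochain {G : Type*} [Group G] {n : ℕ} (π : FreeGroup (Fin n) →* G)
    (f : G → G → ℚ) (hf : ∀ a b c, f b c - f (a * b) c + f a (b * c) - f a b = 0) :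
    ∃ c : FreeGroup (Fin n) → ℚ, ∀ u v, c (u * v) = c u + c v - f (π u) (π v) := by
  letI := CExt.group f hf
  let s : FreeGroup (Fin n) →* CExt G f := FreeGroup.lift fun i => ⟨0, π (FreeGroup.of i)⟩
  let pr : CExt G f →* G := MonoidHom.mk' (fun x => x.g) (fun _ _ => rfl)
  have hs : ∀ u, (s u).g = π u := by
    intro u
    have : pr.comp s = π := by
      ext i
      simp only [MonoidHom.comp_apply, s, FreeGroup.lift_apply_of]
      rfl
    exact DFunLike.congr_fun this u
  refine ⟨fun u => (s u).q, fun u v => ?_⟩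
  rw [← hs u, ← hs v]
  simp only [map_mul]
  rfl

/-- Pairs of a 2-cochain on `G` and a trivialisation of its pullback. -/
def pairW {G : Type*} [Group G] {n : ℕ} (π : FreeGroup (Fin n) →* G) :
    Submodule ℚ (Module.Dual ℚ (inhomogChains G 2) × (FreeGroup (Fin n) → ℚ)) where
  carrier := {w | ∀ u v, w.2 (u * v) = w.2 u + w.2 v - w.1 (Finsupp.single ![π u, π v] 1)}
  add_mem' := by
    intro a b ha hb u v
    have h1 := ha u v
    have h2 := hb u v
    simp only [Prod.snd_add, Prod.fst_add, Pi.add_apply, LinearMap.add_apply]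
    linarith
  zero_mem' := by intro u v; simp
  smul_mem' := by
    intro t a ha u v
    have h1 := ha u v
    simp only [Prod.smul_snd, Prod.smul_fst, Pi.smul_apply, LinearMap.smul_apply, h1, smul_eq_mul]
    ring

theorem pairW_vanish {G : Type*} [Group G] {n : ℕ} (π : FreeGroup (Fin n) →* G)
    (hπ : Function.Surjective π) (w : pairW π) (x : inhomogChains G 3) :
    w.1.1 (chainsD G 2 x) = 0 := by
  have : w.1.1 ∘ₗ chainsD G 2 = 0 := by
    apply Finsupp.lhom_ext'
    intro g
    ext
    simp only [LinearMap.comp_apply, Finsupp.lsingle_apply, chainsD_two, map_add, map_sub]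
    obtain ⟨a, ha⟩ := hπ (g 0)
    obtain ⟨b, hb⟩ := hπ (g 1)
    obtain ⟨c, hc⟩ := hπ (g 2)
    have h1 := w.2 b c
    have h2 := w.2 (a * b) c
    have h3 := w.2 a (b * c)
    have h4 := w.2 a b
    rw [mul_assoc] at h2
    simp only [map_mul, ha, hb, hc] at h1 h2 h3 h4
    simp only [LinearMap.zero_apply]
    linarith
  exact LinearMap.congr_fun this x

/-- The class in the dual of `H_2`. -/
noncomputable def mapP {G : Type*} [Group G] {n : ℕ} (π : FreeGroup (Fin n) →* G)
    (hπ : Function.Surjective π) : pairW π →ₗ[ℚ] Module.Dual ℚ (grpHomology G 2) where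
  toFun w := Submodule.liftQ _ (w.1.1 ∘ₗ (grpCycles G 2).subtype) (by
    rintro z ⟨x, hx⟩
    simp only [LinearMap.mem_ker, LinearMap.comp_apply, ← hx]
    exact pairW_vanish π hπ w x)
  map_add' a b := by
    apply Submodule.linearMap_qext
    ext z
    rfl
  map_smul' t a := by
    apply Submodule.linearMap_qext
    ext z
    rfl

/-- Evaluation at the relators. -/
def mapRho {G : Type*} [Group G] {n m : ℕ} (π : FreeGroup (Fin n) →* G)
    (rel : Fin m → FreeGroup (Fin n)) : pairW π →ₗ[ℚ] (Fin m → ℚ) where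
  toFun w j := w.1.2 (rel j) - w.1.2 1
  map_add' a b := by
    ext j
    simp
    ring
  map_smul' t a := by
    ext j
    simp
    ring

/-- The homomorphism from the free group with prescribed values. -/
def freeHom {n : ℕ} (a : Fin n → ℚ) : FreeGroup (Fin n) →* Multiplicative ℚ :=
  FreeGroup.lift fun i => Multiplicative.ofAdd (a i)

theorem freeHom_add {n : ℕ} (a b : Fin n → ℚ) : freeHom (a + b) = freeHom a * freeHom b := by
  ext i
  simp [freeHom]

theorem freeHom_smul {n : ℕ} (t : ℚ) (a : Fin n → ℚ) (u : FreeGroup (Fin n)) :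
    (freeHom (t • a) u).toAdd = t * (freeHom a u).toAdd := by
  have : freeHom (t • a) =
      (AddMonoidHom.toMultiplicative (AddMonoidHom.mulLeft t)).comp (freeHom a) := by
    ext i
    simp [freeHom]
  rw [this]
  rfl

/-- Homomorphisms from the free group, as pairs. -/
noncomputable def mapIota {G : Type*} [Group G] {n : ℕ} (π : FreeGroup (Fin n) →* G) :
    (Fin n → ℚ) →ₗ[ℚ] pairW π where
  toFun a := ⟨(0, fun u => (freeHom a u).toAdd), by intro u v; simp⟩
  map_add' a b := by
    ext u
    · simp
    · simp [freeHom_add]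
  map_smul' t a := by
    ext u
    · simp
    · simp [freeHom_smul]

theorem mapP_surj {G : Type*} [Group G] {n : ℕ} (π : FreeGroup (Fin n) →* G)
    (hπ : Function.Surjective π) : Function.Surjective (mapP π hπ) := by
  intro φ
  obtain ⟨f, hf⟩ := LinearMap.exists_extend (φ ∘ₗ Submodule.mkQ _)
  have hf' : ∀ z : grpCycles G 2, f z = φ (Submodule.mkQ _ z) := fun z =>
    LinearMap.congr_fun hf z
  have hv : ∀ x, f (chainsD G 2 x) = 0 := by
    intro x
    have hx : chainsD G 2 x ∈ grpCycles G 2 := chainsD_comp x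
    rw [hf' ⟨_, hx⟩]
    have : Submodule.mkQ (Submodule.comap (grpCycles G 2).subtype (LinearMap.range (chainsD G 2)))
        ⟨_, hx⟩ = 0 := by
      rw [Submodule.mkQ_apply, Submodule.Quotient.mk_eq_zero]
      exact ⟨x, rfl⟩
    rw [this, map_zero]
  obtain ⟨c, hc⟩ := exists_cochain π (fun a b => f (Finsupp.single ![a, b] 1)) (by
    intro a b c
    have := hv (Finsupp.single ![a, b, c] 1)
    rw [chainsD_two] at this
    simpa using this)
  refine ⟨⟨(f, c), hc⟩, ?_⟩
  apply Submodule.linearMap_qext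
  ext z
  exact hf' z

/-- A trivialisation that is trivial on relators descends. -/
theorem descend {G : Type*} [Group G] {n m : ℕ} (π : FreeGroup (Fin n) →* G)
    (rel : Fin m → FreeGroup (Fin n))
    (hker : π.ker = Subgroup.normalClosure (Set.range rel))
    (w : pairW π) (hw : mapRho π rel w = 0) {u v : FreeGroup (Fin n)} (huv : π u = π v) :
    w.1.2 u = w.1.2 v := by
  set c := w.1.2
  have hc : ∀ u v, c (u * v) = c u + c v - w.1.1 (Finsupp.single ![π u, π v] 1) := w.2
  have hr : ∀ x k, π k = 1 → c k = c 1 → c (x * k) = c x := by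
    intro x k h1 h2
    have h3 := hc x k
    have h4 := hc x 1
    rw [map_one, mul_one] at h4
    rw [h1] at h3
    linarith
  let S : Subgroup (FreeGroup (Fin n)) :=
    { carrier := {k | π k = 1 ∧ c k = c 1}
      mul_mem' := by
        rintro a b ⟨ha, ha'⟩ ⟨hb, hb'⟩
        exact ⟨by simp [ha, hb], (hr a b hb hb').trans ha'⟩
      one_mem' := ⟨map_one π, rfl⟩
      inv_mem' := by
        rintro a ⟨ha, ha'⟩
        refine ⟨by simp [ha], ?_⟩
        have := hr a⁻¹ a ha ha'
        rw [inv_mul_cancel] at this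
        exact this.symm }
  have hS : S.Normal := by
    constructor
    rintro k ⟨h1, h2⟩ x
    refine ⟨by simp [h1], ?_⟩
    have h3 := hc (x * k) x⁻¹
    have h4 := hc x x⁻¹
    rw [hr x k h1 h2, map_mul, h1, mul_one] at h3
    rw [mul_inv_cancel] at h4
    rw [h3, ← h4]
  have hle : π.ker ≤ S := by
    rw [hker]
    apply Subgroup.normalClosure_le_normal
    rintro _ ⟨j, rfl⟩
    refine ⟨?_, ?_⟩
    · have : rel j ∈ π.ker := by
        rw [hker]
        exact Subgroup.subset_normalClosure ⟨j, rfl⟩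
      exact this
    · have := congrFun hw j
      exact sub_eq_zero.1 this
  have hm : v⁻¹ * u ∈ S := hle (by simp [MonoidHom.mem_ker, huv])
  have := hr v _ hm.1 hm.2
  simpa using this

theorem ker_le {G : Type*} [Group G] {n m : ℕ} (π : FreeGroup (Fin n) →* G)
    (hπ : Function.Surjective π) (rel : Fin m → FreeGroup (Fin n))
    (hker : π.ker = Subgroup.normalClosure (Set.range rel)) :
    LinearMap.ker (mapRho π rel) ≤ LinearMap.ker (mapP π hπ) := by
  intro w hw
  let s := Function.surjInv hπ
  have hs : ∀ g, π (s g) = g := Function.surjInv_eq hπ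
  let h : Module.Dual ℚ (inhomogChains G 1) :=
    Finsupp.lift ℚ ℚ (Fin 1 → G) fun g => w.1.2 (s (g 0))
  have hh : ∀ g, h (Finsupp.single g 1) = w.1.2 (s (g 0)) := by
    intro g
    simp [h]
  have key : w.1.1 = h ∘ₗ chainsD G 1 := by
    apply Finsupp.lhom_ext'
    intro g
    ext
    simp only [LinearMap.comp_apply, Finsupp.lsingle_apply, chainsD_one, map_add, map_sub, hh]
    have h1 := w.2 (s (g 0)) (s (g 1))
    have h2 : w.1.2 (s (g 0 * g 1)) = w.1.2 (s (g 0) * s (g 1)) :=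
      descend π rel hker w hw (by simp [hs])
    have e : ![g 0, g 1] = g := by
      ext i; fin_cases i <;> rfl
    rw [hs, hs, e] at h1
    simp only [Matrix.cons_val_zero]
    linarith
  apply Submodule.linearMap_qext
  ext z
  change w.1.1 z = 0
  have hz : chainsD G 1 z = 0 := z.2
  rw [key, LinearMap.comp_apply, hz, map_zero]

/-- A one-chain as a class in `H_1`. -/
noncomputable def toH1 (G : Type*) [Group G] : inhomogChains G 1 →ₗ[ℚ] grpHomology G 1 :=
  Submodule.mkQ _ ∘ₗ LinearMap.codRestrict (grpCycles G 1) LinearMap.id (fun x => by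
    change chainsD G 0 x = 0
    rw [chainsD_zero]; rfl)

theorem toH1_surj (G : Type*) [Group G] : Function.Surjective (toH1 G) := by
  intro y
  obtain ⟨z, rfl⟩ := Submodule.mkQ_surjective _ y
  exact ⟨z.1, rfl⟩

theorem toH1_mul {G : Type*} [Group G] (a b : G) :
    toH1 G (Finsupp.single ![a * b] 1) =
      toH1 G (Finsupp.single ![a] 1) + toH1 G (Finsupp.single ![b] 1) := by
  have : toH1 G (chainsD G 1 (Finsupp.single ![a, b] 1)) = 0 := by
    refine (Submodule.Quotient.mk_eq_zero _).2 ?_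
    exact ⟨_, rfl⟩
  rw [chainsD_one, map_add, map_sub] at this
  simp only [Matrix.cons_val_zero, Matrix.cons_val_one] at this
  rw [sub_add_eq_add_sub, sub_eq_zero] at this
  rw [← this, add_comm]

/-- Values of a functional on the generators. -/
noncomputable def mapQ {G : Type*} [Group G] {n : ℕ} (π : FreeGroup (Fin n) →* G) :
    Module.Dual ℚ (grpHomology G 1) →ₗ[ℚ] (Fin n → ℚ) where
  toFun φ i := φ (toH1 G (Finsupp.single ![π (FreeGroup.of i)] 1))
  map_add' a b := rfl
  map_smul' t a := rfl

theorem mapQ_inj {G : Type*} [Group G] {n : ℕ} (π : FreeGroup (Fin n) →* G)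
    (hπ : Function.Surjective π) : Function.Injective (mapQ π) := by
  rw [injective_iff_map_eq_zero]
  intro φ hφ
  let χ : FreeGroup (Fin n) →* Multiplicative ℚ :=
    MonoidHom.mk' (fun u => Multiplicative.ofAdd (φ (toH1 G (Finsupp.single ![π u] 1)))) (by
      intro u v
      rw [map_mul, toH1_mul, map_add, ofAdd_add])
  have hχ : χ = 1 := by
    ext i
    exact congrFun hφ i
  have h0 : φ ∘ₗ toH1 G = 0 := by
    apply Finsupp.lhom_ext'
    intro g
    ext
    obtain ⟨u, hu⟩ := hπ (g 0)
    have e : g = ![π u] := by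
      ext i; fin_cases i; exact hu.symm
    subst e
    exact DFunLike.congr_fun hχ u
  apply LinearMap.ext
  intro y
  obtain ⟨z, rfl⟩ := toH1_surj G y
  exact LinearMap.congr_fun h0 z

theorem ker_le_range {G : Type*} [Group G] {n m : ℕ} (π : FreeGroup (Fin n) →* G)
    (hπ : Function.Surjective π) (rel : Fin m → FreeGroup (Fin n))
    (hker : π.ker = Subgroup.normalClosure (Set.range rel)) :
    LinearMap.ker (mapRho π rel ∘ₗ mapIota π) ≤ LinearMap.range (mapQ π) := by
  intro a ha
  let s := Function.surjInv hπ
  have hs : ∀ g, π (s g) = g := Function.surjInv_eq hπ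
  have hd : ∀ u v, π u = π v → (freeHom a u).toAdd = (freeHom a v).toAdd := fun u v huv =>
    descend π rel hker (mapIota π a) ha huv
  let h : Module.Dual ℚ (inhomogChains G 1) :=
    Finsupp.lift ℚ ℚ (Fin 1 → G) fun g => (freeHom a (s (g 0))).toAdd
  have hh : ∀ g, h (Finsupp.single g 1) = (freeHom a (s (g 0))).toAdd := by
    intro g
    simp [h]
  have key : h ∘ₗ chainsD G 1 = 0 := by
    apply Finsupp.lhom_ext'
    intro g
    ext
    simp only [LinearMap.comp_apply, Finsupp.lsingle_apply, chainsD_one, map_add, map_sub, hh]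
    have h2 := hd (s (g 0 * g 1)) (s (g 0) * s (g 1)) (by simp [hs])
    rw [map_mul, toAdd_mul] at h2
    simp only [Matrix.cons_val_zero, LinearMap.zero_apply]
    linarith
  refine ⟨Submodule.liftQ _ (h ∘ₗ (grpCycles G 1).subtype) ?_, ?_⟩
  · rintro z ⟨x, hx⟩
    simp only [LinearMap.mem_ker, LinearMap.comp_apply, ← hx]
    exact LinearMap.congr_fun key x
  · ext i
    change h (Finsupp.single ![π (FreeGroup.of i)] 1) = a i
    rw [hh]
    refine (hd _ (FreeGroup.of i) (hs _)).trans ?_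
    simp [freeHom]

theorem stmt_7 {G : Type*} [Group G] {e₁ e₂ : ℕ} (hG : HasPresentation G e₁ e₂) :
    (e₁ : ℤ) - (e₂ : ℤ) ≤ (bettiNumber G 1 : ℤ) - (bettiNumber G 2 : ℤ) := by
  obtain ⟨rel, ⟨e⟩⟩ := hG
  let π : FreeGroup (Fin e₁) →* G :=
    e.symm.toMonoidHom.comp (QuotientGroup.mk' (Subgroup.normalClosure (Set.range rel)))
  have hπ : Function.Surjective π :=
    e.symm.surjective.comp (QuotientGroup.mk'_surjective _)
  have hker : π.ker = Subgroup.normalClosure (Set.range rel) := by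
    ext x
    simp [π, MonoidHom.mem_ker]
  have h := dim_count (mapP π hπ) (mapRho π rel) (mapIota π) (mapP_surj π hπ)
    (ker_le π hπ rel hker) (by
      intro x
      apply Submodule.linearMap_qext
      ext z
      rfl)
  have h2 := Submodule.finrank_mono (ker_le_range π hπ rel hker)
  rw [LinearMap.finrank_range_of_inj (mapQ_inj π hπ)] at h2
  rw [Subspace.dual_finrank_eq] at h h2
  simp only [Module.finrank_fin_fun] at h
  unfold bettiNumber
  omega
end
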